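/- For all integers r ≥ 3, there exists n₁ ∈ ℕ such that for all n ≥ n₁ and every proper subset A ⊂ [n], we have g_r(A) < g_r([n]). In particular, [n] is the unique subset of [n] maximizing the number of rainbow 3-AP-free r-colorings. -/

import Mathlib

/-- A coloring `c : A → Fin r` is rainbow 3-AP-free if no 3-AP of `A`
(i.e. a triple `(a, a+d, a+2d)` with `d ≥ 1` and all three elements in `A`)
receives three pairwise distinct colors. -/
def RainbowAPFree {r : ℕ} (A : Finset ℕ) (c : A → Fin r) : Prop :=
  ∀ a d : ℕ, 0 < d → ∀ (h1 : a ∈ A) (h2 : a + d ∈ A) (h3 : a + 2 * d ∈ A),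
    c ⟨a, h1⟩ = c ⟨a + d, h2⟩ ∨ c ⟨a + d, h2⟩ = c ⟨a + 2 * d, h3⟩ ∨
      c ⟨a, h1⟩ = c ⟨a + 2 * d, h3⟩

/-- `g r A` is the number of rainbow 3-AP-free `r`-colorings of `A`. -/
noncomputable def g (r : ℕ) (A : Finset ℕ) : ℕ :=
  Nat.card {c : A → Fin r // RainbowAPFree A c}

open Finset


lemma count_near {X V : Type*} [Fintype X] [DecidableEq X] [Fintype V] [DecidableEq V]
    (L : X → Finset V) (S : Finset (X → V)) (t K : ℝ) (ht : 0 < t) (ht1 : t ≤ 1)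
    (h : ∀ c ∈ S, ((univ.filter (fun x => c x ∉ L x)).card : ℝ) ≤ K) :
    (S.card : ℝ) ≤ Real.exp (K * Real.log (1 / t)) *
      ∏ x, ((L x).card + t * Fintype.card V : ℝ) := by
  have h1 : ∀ c ∈ S, Real.exp (-(K * Real.log (1/t))) ≤ ∏ x, (if c x ∈ L x then (1:ℝ) else t) := by
    intro c hc
    have h2 : ∏ x, (if c x ∈ L x then (1:ℝ) else t) = t ^ (univ.filter (fun x => c x ∉ L x)).card := by
      rw [Finset.prod_ite]; simp
    rw [h2, ← Real.rpow_natCast, Real.rpow_def_of_pos ht]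
    apply Real.exp_le_exp.mpr
    rw [one_div, Real.log_inv]
    have := h c hc
    have hl : Real.log t ≤ 0 := Real.log_nonpos ht.le ht1
    nlinarith
  have h3 : ∑ c : X → V, ∏ x, (if c x ∈ L x then (1:ℝ) else t)
      = ∏ x, ∑ v, (if v ∈ L x then (1:ℝ) else t) := by
    rw [Finset.prod_univ_sum]; simp
  have h4 : ∏ x, ∑ v, (if v ∈ L x then (1:ℝ) else t) ≤
      ∏ x, ((L x).card + t * Fintype.card V : ℝ) := by
    apply Finset.prod_le_prod
    · intro x _; apply Finset.sum_nonneg; intro v _; split_ifs <;> positivity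
    · intro x _
      calc ∑ v, (if v ∈ L x then (1:ℝ) else t) ≤ ∑ v, ((if v ∈ L x then (1:ℝ) else 0) + t) := by
            apply Finset.sum_le_sum; intro v _; split_ifs <;> linarith
        _ = _ := by rw [Finset.sum_add_distrib]; simp; ring
  have h5 : (S.card : ℝ) * Real.exp (-(K * Real.log (1/t))) ≤
      ∏ x, ((L x).card + t * Fintype.card V : ℝ) := by
    rw [← nsmul_eq_mul, ← Finset.sum_const]
    calc _ ≤ ∑ c ∈ S, ∏ x, (if c x ∈ L x then (1:ℝ) else t) := Finset.sum_le_sum h1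
      _ ≤ ∑ c : X → V, ∏ x, (if c x ∈ L x then (1:ℝ) else t) := by
        apply Finset.sum_le_sum_of_subset_of_nonneg (subset_univ _)
        intro c _ _; apply Finset.prod_nonneg; intro x _; split_ifs <;> positivity
      _ ≤ _ := by rw [h3]; exact h4
  rw [Real.exp_neg] at h5
  have := Real.exp_pos (K * Real.log (1/t))
  rw [← div_eq_mul_inv, div_le_iff₀ this] at h5
  linarith

noncomputable def fhat {N : ℕ} [NeZero N] (f : ZMod N → ℂ) (k : ZMod N) : ℂ :=
  ∑ x, f x * ZMod.stdAddChar (k * x)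

noncomputable def tcount {N : ℕ} [NeZero N] (f g h : ZMod N → ℂ) : ℂ :=
  ∑ x, ∑ y, f x * g y * h (2 * y - x)

lemma char_orth {N : ℕ} [NeZero N] (a : ZMod N) :
    ∑ k : ZMod N, (ZMod.stdAddChar (k * a) : ℂ) = if a = 0 then (N : ℂ) else 0 := by
  have := AddChar.sum_mulShift (R' := ℂ) a (ZMod.isPrimitive_stdAddChar N)
  rw [this, ZMod.card]
  split_ifs <;> simp

lemma fhat_parseval {N : ℕ} [NeZero N] (f : ZMod N → ℂ) :
    ∑ k, ‖fhat f k‖ ^ 2 = N * ∑ x, ‖f x‖ ^ 2 := by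
  have key : ∑ k, fhat f k * (starRingEnd ℂ) (fhat f k) = N * ∑ x, f x * (starRingEnd ℂ) (f x) := by
    have : ∀ k, fhat f k * (starRingEnd ℂ) (fhat f k) =
        ∑ x, ∑ y, f x * (starRingEnd ℂ) (f y) * ZMod.stdAddChar (k * (x - y)) := by
      intro k
      rw [fhat, map_sum, Finset.sum_mul_sum]
      refine Finset.sum_congr rfl fun x _ => Finset.sum_congr rfl fun y _ => ?_
      rw [map_mul (starRingEnd ℂ), ← AddChar.map_neg_eq_conj, mul_sub, sub_eq_add_neg, AddChar.map_add_eq_mul]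
      ring
    simp_rw [this]
    rw [Finset.sum_comm]
    rw [Finset.mul_sum]
    refine Finset.sum_congr rfl fun x _ => ?_
    rw [Finset.sum_comm]
    simp_rw [← Finset.mul_sum, char_orth, sub_eq_zero]
    simp
    ring
  have h2 : ((∑ k, ‖fhat f k‖ ^ 2 : ℝ) : ℂ) = ((N * ∑ x, ‖f x‖ ^ 2 : ℝ) : ℂ) := by
    push_cast
    simp_rw [Complex.mul_conj'] at key
    exact key
  exact_mod_cast h2

lemma tcount_fourier {N : ℕ} [NeZero N] (f g h : ZMod N → ℂ) :
    (N : ℂ) * tcount f g h = ∑ k, fhat f k * fhat g (-(2 * k)) * fhat h k := by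
  have : ∀ k, fhat f k * fhat g (-(2 * k)) * fhat h k =
      ∑ x, ∑ y, ∑ z, f x * g y * h z * ZMod.stdAddChar (k * (x - 2 * y + z)) := by
    intro k
    rw [fhat, fhat, fhat, Finset.sum_mul_sum, Finset.sum_mul]
    refine Finset.sum_congr rfl fun x _ => ?_
    rw [Finset.sum_mul]
    refine Finset.sum_congr rfl fun y _ => ?_
    rw [Finset.mul_sum]
    refine Finset.sum_congr rfl fun z _ => ?_
    have : k * (x - 2 * y + z) = k * x + (-(2*k)) * y + k * z := by ring
    rw [this, AddChar.map_add_eq_mul, AddChar.map_add_eq_mul]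
    ring
  simp_rw [this]
  rw [Finset.sum_comm, tcount, Finset.mul_sum]
  refine Finset.sum_congr rfl fun x _ => ?_
  rw [Finset.sum_comm, Finset.mul_sum]
  refine Finset.sum_congr rfl fun y _ => ?_
  rw [Finset.sum_comm]
  simp_rw [← Finset.mul_sum, char_orth]
  rw [Finset.sum_eq_single (2 * y - x)]
  · rw [if_pos (by ring)]; ring
  · intro z _ hz
    rw [if_neg]; · ring
    intro h; apply hz; linear_combination h
  · simp

lemma sum_parseval_le {N : ℕ} [NeZero N] (f : ZMod N → ℂ) (hf : ∀ x, ‖f x‖ ≤ 1) :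
    ∑ k, ‖fhat f k‖ ^ 2 ≤ (N:ℝ) * N := by
  rw [fhat_parseval]
  apply mul_le_mul_of_nonneg_left _ (by positivity)
  calc ∑ x, ‖f x‖ ^ 2 ≤ ∑ x : ZMod N, (1:ℝ) := by
        apply Finset.sum_le_sum; intro x _
        have := norm_nonneg (f x); have := hf x; nlinarith
    _ = N := by simp [ZMod.card]

lemma sum_twist {N : ℕ} [NeZero N] (hN : Odd N) (F : ZMod N → ℝ) :
    ∑ k, F (-(2 * k)) = ∑ k, F k := by
  have hu : IsUnit (2 : ZMod N) := by
    have : ((2:ℕ) : ZMod N) = 2 := by norm_cast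
    rw [← this, ZMod.isUnit_iff_coprime]
    exact (Nat.coprime_two_left).mpr hN
  obtain ⟨u, hu⟩ := hu
  refine Fintype.sum_equiv ((Units.mulLeft u).trans (Equiv.neg _)) _ _ ?_
  intro x; simp [hu]

lemma three_bound {N : ℕ} [NeZero N] (a b c : ZMod N → ℂ) (s : ℝ) (hs : 0 ≤ s)
    (ha : ∀ k, ‖a k‖ ≤ s) (hb : ∑ k, ‖b k‖ ^ 2 ≤ (N:ℝ) * N) (hc : ∑ k, ‖c k‖ ^ 2 ≤ (N:ℝ) * N) :
    ‖∑ k, a k * b k * c k‖ ≤ s * (N * N) := by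
  calc ‖∑ k, a k * b k * c k‖ ≤ ∑ k, ‖a k * b k * c k‖ := norm_sum_le _ _
    _ ≤ ∑ k, (s/2 * ‖b k‖ ^ 2 + s/2 * ‖c k‖ ^ 2) := by
      apply Finset.sum_le_sum; intro k _
      rw [norm_mul, norm_mul]
      have h1 := ha k
      have h2 := norm_nonneg (a k)
      have h3 : 0 ≤ ‖b k‖ * ‖c k‖ := by positivity
      nlinarith [sq_nonneg (‖b k‖ - ‖c k‖), mul_le_mul_of_nonneg_right h1 h3]
    _ = s/2 * ∑ k, ‖b k‖ ^ 2 + s/2 * ∑ k, ‖c k‖ ^ 2 := by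
      rw [Finset.sum_add_distrib, Finset.mul_sum, Finset.mul_sum]
    _ ≤ _ := by nlinarith

lemma tcount_bound2 {N : ℕ} [NeZero N] (f u h : ZMod N → ℂ) (s : ℝ) (hs : 0 ≤ s)
    (hu : ∀ k, ‖fhat u k‖ ≤ s) (hf : ∀ x, ‖f x‖ ≤ 1) (hh : ∀ x, ‖h x‖ ≤ 1) :
    ‖tcount f u h‖ ≤ s * N := by
  have h1 := three_bound (fun k => fhat u (-(2*k))) (fhat f) (fhat h) s hs (fun k => hu _)
    (sum_parseval_le f hf) (sum_parseval_le h hh)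
  have h2 := tcount_fourier f u h
  have h3 : ∑ k, fhat f k * fhat u (-(2 * k)) * fhat h k =
    ∑ k, fhat u (-(2*k)) * fhat f k * fhat h k := by
    refine Finset.sum_congr rfl fun k _ => by ring
  rw [← h3, ← h2, norm_mul, Complex.norm_natCast] at h1
  have : (0:ℝ) < N := by exact_mod_cast Nat.pos_of_ne_zero (NeZero.ne N)
  nlinarith [mul_pos this this]

lemma tcount_bound3 {N : ℕ} [NeZero N] (hN : Odd N) (f g u : ZMod N → ℂ) (s : ℝ) (hs : 0 ≤ s)
    (hu : ∀ k, ‖fhat u k‖ ≤ s) (hf : ∀ x, ‖f x‖ ≤ 1) (hg : ∀ x, ‖g x‖ ≤ 1) :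
    ‖tcount f g u‖ ≤ s * N := by
  have h1 := three_bound (fhat u) (fhat f) (fun k => fhat g (-(2*k))) s hs hu
    (sum_parseval_le f hf) (by
      rw [sum_twist hN (fun k => ‖fhat g k‖ ^ 2)]
      exact sum_parseval_le g hg)
  have h2 := tcount_fourier f g u
  have h3 : ∑ k, fhat f k * fhat g (-(2 * k)) * fhat u k =
    ∑ k, fhat u k * fhat f k * fhat g (-(2*k)) := by
    refine Finset.sum_congr rfl fun k _ => by ring
  rw [← h3, ← h2, norm_mul, Complex.norm_natCast] at h1
  have : (0:ℝ) < N := by exact_mod_cast Nat.pos_of_ne_zero (NeZero.ne N)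
  nlinarith [mul_pos this this]

/-- replacing two functions by Fourier-close ones changes the count little -/
lemma tcount_close {N : ℕ} [NeZero N] (hN : Odd N) (f g h g' h' : ZMod N → ℂ) (s : ℝ) (hs : 0 ≤ s)
    (hg' : ∀ k, ‖fhat g k - fhat g' k‖ ≤ s) (hh' : ∀ k, ‖fhat h k - fhat h' k‖ ≤ s)
    (bf : ∀ x, ‖f x‖ ≤ 1) (bg : ∀ x, ‖g x‖ ≤ 1) (bh : ∀ x, ‖h' x‖ ≤ 1)
    (h0 : tcount f g h = 0) : ‖tcount f g' h'‖ ≤ 2 * s * N := by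
  have e1 : ∀ a b : ZMod N → ℂ, ∀ k, fhat (fun x => a x - b x) k = fhat a k - fhat b k := by
    intro a b k; simp only [fhat, sub_mul, Finset.sum_sub_distrib]
  have e2 : tcount f g' h' = tcount f g h - tcount f g (fun x => h x - h' x)
      - tcount f (fun x => g x - g' x) h' := by
    simp only [tcount, ← Finset.sum_sub_distrib]
    refine Finset.sum_congr rfl fun x _ => Finset.sum_congr rfl fun y _ => by ring
  have b1 := tcount_bound3 hN f g (fun x => h x - h' x) s hs (by intro k; rw [e1]; exact hh' k) bf bg
  have b2 := tcount_bound2 f (fun x => g x - g' x) h' s hs (by intro k; rw [e1]; exact hg' k) bf bh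
  rw [e2, h0, zero_sub]
  calc _ ≤ ‖-tcount f g (fun x => h x - h' x)‖ + ‖tcount f (fun x => g x - g' x) h'‖ := norm_sub_le _ _
    _ ≤ _ := by rw [norm_neg]; linarith

abbrev boxV (M : ℕ) : Type := ↥((Finset.Icc (-(M:ℤ)) M) ×ˢ (Finset.Icc (-(M:ℤ)) M))

lemma fhat_norm_le {N : ℕ} [NeZero N] (f : ZMod N → ℂ) (hf : ∀ x, ‖f x‖ ≤ 1) (k : ZMod N) :
    ‖fhat f k‖ ≤ N := by
  calc ‖fhat f k‖ ≤ ∑ x, ‖f x * ZMod.stdAddChar (k * x)‖ := norm_sum_le _ _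
    _ ≤ ∑ x : ZMod N, (1:ℝ) := by
      apply Finset.sum_le_sum; intro x _
      rw [norm_mul, AddChar.norm_apply, mul_one]; exact hf x
    _ = N := by simp [ZMod.card]

lemma round_abs_le (x : ℝ) (M : ℕ) (h : |x| ≤ M) : round x ∈ Finset.Icc (-(M:ℤ)) M := by
  have h1 := abs_le.mp (abs_sub_round x)
  have h2 := abs_le.mp h
  rw [Finset.mem_Icc]
  constructor
  · have : (-(M:ℤ) : ℝ) - 1 < round x := by push_cast; linarith
    have : (-(M:ℤ)) - 1 < round x := by exact_mod_cast this
    linarith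
  · have : (round x : ℝ) < (M:ℤ) + 1 := by push_cast; linarith
    have : (round x) < (M:ℤ) + 1 := by exact_mod_cast this
    linarith

lemma types (r : ℕ) (δ κ : ℝ) (hδ : 0 < δ) (hκ : 0 < κ) : ∃ (M : ℕ) (C : ℝ), 0 < C ∧
    ∀ (N : ℕ) [NeZero N] {α : Type} (f : α → Fin r → ZMod N → ℂ),
      (∀ c i x, ‖f c i x‖ ≤ 1) → ∃ Φ : α → (Fin r × ZMod N → boxV M),
        (∀ S : Finset α, ((S.image Φ).card : ℝ) ≤ C * Real.exp (κ * N)) ∧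
        (∀ c c', Φ c = Φ c' → ∀ i k, ‖fhat (f c i) k - fhat (f c' i) k‖ ≤ 2 * δ * N) := by
  obtain ⟨M, hM⟩ := exists_nat_ge (1/δ)
  set v : ℝ := ((Fintype.card (boxV M) : ℕ) : ℝ) with hv
  have hv0 : 0 ≤ v := by positivity
  set t : ℝ := min 1 (κ / (v * r + 1)) with ht
  have ht0 : 0 < t := by rw [ht]; apply lt_min one_pos; positivity
  have ht1 : t ≤ 1 := min_le_left _ _
  have htv : t * v * r ≤ κ := by
    have : t ≤ κ / (v * r + 1) := min_le_right _ _
    rw [le_div_iff₀ (by positivity)] at this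
    nlinarith
  set K : ℝ := 4 * r / δ^2 with hK
  refine ⟨M, Real.exp (K * Real.log (1/t)), Real.exp_pos _, ?_⟩
  intro N _ α f hf
  have hN : (0:ℝ) < N := by exact_mod_cast Nat.pos_of_ne_zero (NeZero.ne N)
  have hdN : 0 < δ * N := by positivity
  have hb : ∀ c i k, |(fhat (f c i) k).re / (δ * N)| ≤ M ∧ |(fhat (f c i) k).im / (δ * N)| ≤ M := by
    intro c i k
    have h1 := fhat_norm_le (f c i) (hf c i) k
    have h2 := Complex.abs_re_le_norm (fhat (f c i) k)
    have h3 := Complex.abs_im_le_norm (fhat (f c i) k)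
    have h4 : (N:ℝ) / (δ * N) = 1 / δ := by field_simp
    constructor <;> rw [abs_div, abs_of_pos hdN] <;> refine le_trans ?_ hM <;> rw [← h4] <;>
      gcongr <;> linarith
  let Φ : α → (Fin r × ZMod N → boxV M) := fun c p =>
    ⟨(round ((fhat (f c p.1) p.2).re / (δ * N)), round ((fhat (f c p.1) p.2).im / (δ * N))), by
      rw [Finset.mem_product]
      exact ⟨round_abs_le _ _ (hb c p.1 p.2).1, round_abs_le _ _ (hb c p.1 p.2).2⟩⟩
  let z : boxV M := ⟨(0,0), by simp⟩
  refine ⟨Φ, ?_, ?_⟩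
  · intro S
    have := count_near (fun _ : Fin r × ZMod N => ({z} : Finset (boxV M))) (S.image Φ) t K ht0 ht1 ?_
    · refine this.trans ?_
      apply mul_le_mul_of_nonneg_left _ (Real.exp_pos _).le
      rw [Finset.prod_const, Finset.card_singleton, ← hv]
      have e1 : ((1:ℕ):ℝ) + t * v ≤ Real.exp (t * v) := by
        have := Real.add_one_le_exp (t*v); push_cast; linarith
      calc _ ≤ (Real.exp (t * v)) ^ (univ : Finset (Fin r × ZMod N)).card := by
            gcongr
        _ = Real.exp ((r * N) * (t * v)) := by
            rw [← Real.exp_nat_mul]; simp [ZMod.card]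
        _ ≤ _ := by
            apply Real.exp_le_exp.mpr
            nlinarith
    · intro c' hc'
      obtain ⟨c, hc, rfl⟩ := Finset.mem_image.mp hc'
      have hsub : ∀ p : Fin r × ZMod N, Φ c p ∉ ({z} : Finset (boxV M)) →
          δ^2 * N^2/4 ≤ ‖fhat (f c p.1) p.2‖^2 := by
        intro p hp
        by_contra hlt
        push Not at hlt
        apply hp
        rw [Finset.mem_singleton]
        have hn : ‖fhat (f c p.1) p.2‖ < δ * N / 2 := by
          apply lt_of_pow_lt_pow_left₀ 2 (by positivity)
          calc _ < _ := hlt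
            _ = _ := by ring
        have h2 := Complex.abs_re_le_norm (fhat (f c p.1) p.2)
        have h3 := Complex.abs_im_le_norm (fhat (f c p.1) p.2)
        have g : ∀ x : ℝ, |x| < δ * N / 2 → round (x / (δ * N)) = 0 := by
          intro x hx
          rw [round_eq_zero_iff, Set.mem_Ico]
          have := abs_lt.mp hx
          constructor
          · rw [le_div_iff₀ hdN]; linarith
          · rw [div_lt_iff₀ hdN]; linarith
        apply Subtype.ext
        simp only [Φ, z]
        rw [g _ (by linarith), g _ (by linarith)]
      have hcard : ((univ.filter (fun p => Φ c p ∉ ({z} : Finset (boxV M)))).card : ℝ) * (δ^2 * N^2/4)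
          ≤ r * (N * N) := by
        rw [← nsmul_eq_mul, ← Finset.sum_const]
        calc _ ≤ ∑ p ∈ univ.filter (fun p => Φ c p ∉ ({z} : Finset (boxV M))), ‖fhat (f c p.1) p.2‖^2 := by
              apply Finset.sum_le_sum; intro p hp
              exact hsub p (Finset.mem_filter.mp hp).2
          _ ≤ ∑ p : Fin r × ZMod N, ‖fhat (f c p.1) p.2‖^2 := by
              apply Finset.sum_le_sum_of_subset_of_nonneg (subset_univ _)
              intros; positivity
          _ = ∑ i, ∑ k, ‖fhat (f c i) k‖^2 := by rw [Fintype.sum_prod_type]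
          _ ≤ ∑ i : Fin r, ((N:ℝ) * N) := by
              apply Finset.sum_le_sum; intro i _; exact sum_parseval_le _ (hf c i)
          _ = _ := by simp
      rw [hK, le_div_iff₀ (by positivity)]
      have hN2 : (0:ℝ) < N^2 := by positivity
      have := le_of_mul_le_mul_right (a := (N:ℝ)^2)
        (b := ((univ.filter (fun p => Φ c p ∉ ({z} : Finset (boxV M)))).card : ℝ) * δ^2) (c := 4 * r)
        (by linarith) hN2
      exact this
  · intro c c' h i k
    have h1 := congrArg Subtype.val (congrFun h (i, k))
    simp only [Φ, Prod.mk.injEq] at h1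
    have g : ∀ x y : ℝ, round (x / (δ*N)) = round (y / (δ * N)) → |x - y| ≤ δ * N := by
      intro x y hxy
      have a1 := abs_sub_round (x / (δ*N))
      have a2 := abs_sub_round (y / (δ*N))
      rw [hxy] at a1
      have : |x / (δ*N) - y/(δ*N)| ≤ 1 := by
        rw [abs_le] at *
        constructor <;> linarith [a1.1, a1.2, a2.1, a2.2]
      rw [← sub_div, abs_div, abs_of_pos hdN, div_le_one hdN] at this
      exact this
    have g1 := g _ _ h1.1
    have g2 := g _ _ h1.2
    rw [← Complex.sub_re] at g1
    rw [← Complex.sub_im] at g2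
    have := Complex.norm_le_abs_re_add_abs_im (fhat (f c i) k - fhat (f c' i) k)
    linarith

/-- ordered (possibly trivial) three term progressions in `Fin n` -/
def apT (n : ℕ) : Finset (Fin n × Fin n × Fin n) :=
  univ.filter (fun p => (p.1 : ℕ) + p.2.2 = 2 * p.2.1)

lemma mem_apT {n : ℕ} (x y z : Fin n) : (x, y, z) ∈ apT n ↔ (x : ℕ) + z = 2 * y := by
  simp [apT]

lemma roth_small (ε : ℝ) (hε : 0 < ε) : ∃ M : ℕ, 0 < M ∧ (rothNumberNat M : ℝ) ≤ ε * M := by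
  have h := rothNumberNat_isLittleO_id
  rw [Asymptotics.isLittleO_iff] at h
  have h1 := h hε
  obtain ⟨M, hM, hM2⟩ := (h1.and (Filter.eventually_gt_atTop 0)).exists
  refine ⟨M, hM2, ?_⟩
  simpa using hM

lemma exists_ap_of_roth (M : ℕ) (J : Finset ℕ) (hJ : J ⊆ range M) (h : rothNumberNat M < J.card) :
    ∃ a ∈ J, ∃ b ∈ J, ∃ c ∈ J, a + c = 2 * b ∧ a ≠ b := by
  by_contra hcon
  push Not at hcon
  have : ThreeAPFree (J : Set ℕ) := by
    intro a ha b hb c hc habc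
    exact hcon a ha b hb c hc (by omega)
  have := this.le_rothNumberNat J (fun x hx => by simpa using hJ hx) rfl
  omega

lemma varnavides (ε : ℝ) (hε : 0 < ε) : ∃ c : ℝ, 0 < c ∧ ∃ n₀ : ℕ, ∀ n ≥ n₀, ∀ B : Finset (Fin n),
    ε * n ≤ B.card →
    c * (n:ℝ)^2 ≤ ((apT n).filter (fun p => p.1 ∈ B ∧ p.2.1 ∈ B ∧ p.2.2 ∈ B)).card := by
  obtain ⟨M, hM0, hM⟩ := roth_small (ε/4) (by positivity)
  refine ⟨ε / (4 * M^3), by positivity, M, ?_⟩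
  intro n hn B hB
  set P := (apT n).filter (fun p => p.1 ∈ B ∧ p.2.1 ∈ B ∧ p.2.2 ∈ B) with hP
  set D := n / M with hD
  let J : ℕ × ℕ → Finset ℕ := fun q => (range M).filter (fun j => ∃ b ∈ B, (b:ℕ) + n = q.1 + j * q.2)
  let I : Finset (ℕ × ℕ) := range (2*n) ×ˢ Icc 1 D
  let G : Finset (ℕ × ℕ) := I.filter (fun q => rothNumberNat M < (J q).card)
  have hMD : M * D ≤ n := Nat.mul_div_le n M
  -- lower bound of the sum
  have low : M * B.card * D ≤ ∑ q ∈ I, (J q).card := by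
    have : (range M ×ˢ B ×ˢ Icc 1 D).card ≤ (I.sigma J).card := by
      apply Finset.card_le_card_of_injOn
        (fun p => (⟨((p.2.1 : ℕ) + n - p.1 * p.2.2, p.2.2), p.1⟩ : (_ : ℕ × ℕ) × ℕ))
      · rintro ⟨j, b, d⟩ h
        simp only [coe_product, Set.mem_prod, mem_coe, mem_range, mem_Icc] at h
        obtain ⟨hj, hb, hd1, hd2⟩ := h
        have hjd : j * d ≤ n := by
          calc j * d ≤ M * D := Nat.mul_le_mul hj.le hd2
            _ ≤ n := hMD
        simp only [I, J, mem_coe, mem_sigma, mem_product, mem_range, mem_Icc, mem_filter]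
        have := b.2
        refine ⟨⟨by omega, hd1, hd2⟩, hj, b, hb, by omega⟩
      · rintro ⟨j, b, d⟩ h ⟨j', b', d'⟩ h' heq
        simp only [coe_product, Set.mem_prod, mem_coe, mem_range, mem_Icc] at h h'
        simp only [Sigma.mk.injEq, Prod.mk.injEq, heq_eq_eq] at heq
        obtain ⟨⟨h1, rfl⟩, rfl⟩ := heq
        have hjd : j * d ≤ n := by
          calc j * d ≤ M * D := Nat.mul_le_mul h.1.le h.2.2.2
            _ ≤ n := hMD
        have : b = b' := Fin.ext (by omega)
        rw [this]
    rw [card_sigma, card_product, card_product] at this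
    simpa [mul_assoc] using this
  have up : ∑ q ∈ I, (J q).card ≤ G.card * M + (2 * n * D) * rothNumberNat M := by
    rw [← Finset.sum_filter_add_sum_filter_not I (fun q => rothNumberNat M < (J q).card)]
    apply Nat.add_le_add
    · rw [← smul_eq_mul]
      apply Finset.sum_le_card_nsmul
      intro q _
      calc (J q).card ≤ (range M).card := card_filter_le _ _
        _ = M := card_range M
    · calc _ ≤ (I.filter (fun q => ¬ rothNumberNat M < (J q).card)).card • rothNumberNat M := by
            apply Finset.sum_le_card_nsmul
            intro q hq
            exact not_lt.mp (mem_filter.mp hq).2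
        _ ≤ I.card * rothNumberNat M := Nat.mul_le_mul_right _ (card_filter_le _ _)
        _ = _ := by simp [I]
  have hG : G.card ≤ P.card * M^2 := by
    have key : ∀ q ∈ G, ∃ p ∈ P, ∃ j ∈ range M, ∃ j' ∈ range M, j ≠ j' ∧
        (p.1 : ℕ) + n = q.1 + j * q.2 ∧ (p.2.1 : ℕ) + n = q.1 + j' * q.2 := by
      rintro ⟨a, d⟩ hq
      simp only [G, mem_filter] at hq
      obtain ⟨j1, h1, j2, h2, j3, h3, hs, hne⟩ := exists_ap_of_roth M (J (a, d)) (filter_subset _ _) hq.2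
      simp only [J, mem_filter] at h1 h2 h3
      obtain ⟨m1, b1, hb1, e1⟩ := h1
      obtain ⟨m2, b2, hb2, e2⟩ := h2
      obtain ⟨m3, b3, hb3, e3⟩ := h3
      refine ⟨(b1, b2, b3), ?_, j1, m1, j2, m2, hne, e1, e2⟩
      simp only [hP, mem_filter, mem_apT]
      refine ⟨?_, hb1, hb2, hb3⟩
      have : j1 * d + j3 * d = 2 * (j2 * d) := by rw [← add_mul, hs]; ring
      omega
    have : NeZero n := ⟨by omega⟩
    choose! p hp j hj j' hj' hne e1 e2 using key
    have : G.card ≤ (P ×ˢ range M ×ˢ range M).card := by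
      apply Finset.card_le_card_of_injOn (fun q => (p q, j q, j' q))
      · intro q hq
        simp only [coe_product, Set.mem_prod, mem_coe]
        exact ⟨hp q hq, hj q hq, hj' q hq⟩
      · rintro ⟨a, d⟩ hq ⟨a', d'⟩ hq' heq
        simp only [Prod.mk.injEq] at heq
        obtain ⟨g1, g2, g3⟩ := heq
        have f1 := e1 _ hq; have f2 := e2 _ hq; have f3 := e1 _ hq'; have f4 := e2 _ hq'
        have f5 := hne _ hq
        rw [← g1, ← g2] at f3
        rw [← g1, ← g3] at f4
        generalize j (a, d) = u at *
        generalize j' (a, d) = v at *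
        simp only at f1 f2 f3 f4
        have hdd : d = d' := by
          have : ((u:ℤ) - v) * ((d:ℤ) - d') = 0 := by
            zify at f1 f2 f3 f4
            linear_combination (-f1 + f2 + f3 - f4)
          rcases mul_eq_zero.mp this with h | h
          · exact absurd (by omega) f5
          · omega
        subst hdd
        have : a = a' := by omega
        rw [this]
    rw [card_product, card_product, card_range] at this
    calc _ ≤ _ := this
      _ = _ := by ring
  have hDl : (n:ℝ) ≤ 2 * M * D := by
    have h1 : 1 ≤ D := (Nat.one_le_div_iff hM0).mpr hn
    have h2 : n < M * D + M := by
      have := Nat.lt_mul_div_succ n hM0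
      rw [← hD] at this; linarith
    have : n ≤ 2 * M * D := by nlinarith
    exact_mod_cast this
  have hMr : (0:ℝ) < M := by exact_mod_cast hM0
  have c1 : (M:ℝ) * B.card * D ≤ G.card * M + (2 * n * D) * rothNumberNat M := by
    exact_mod_cast low.trans up
  have hGr : (G.card : ℝ) ≤ P.card * M^2 := by exact_mod_cast hG
  have c2 : ε / 2 * n * D ≤ G.card := by
    have t1 : (M:ℝ) * (ε * n) * D ≤ M * B.card * D := by gcongr
    have t2 : (2 * (n:ℝ) * D) * rothNumberNat M ≤ (2 * n * D) * (ε/4 * M) := by gcongr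
    have : (M:ℝ) * (ε / 2 * n * D) ≤ M * G.card := by linarith
    exact le_of_mul_le_mul_left this hMr
  have c3 : ε * n^2 ≤ 4 * M^3 * P.card := by
    have : ε * n^2 ≤ ε * n * (2 * M * D) := by
      rw [pow_two, ← mul_assoc]; gcongr
    have t3 : 4 * M * (ε / 2 * n * D) ≤ 4 * M * (P.card * (M:ℝ)^2) :=
      mul_le_mul_of_nonneg_left (c2.trans hGr) (by positivity)
    nlinarith
  rw [div_mul_eq_mul_div, div_le_iff₀ (by positivity)]
  linarith

noncomputable def indZ {n : ℕ} (P : Finset (Fin n)) (u : ZMod (2 * n + 1)) : ℂ :=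
  ∑ x ∈ P, if (((x : ℕ) : ZMod (2 * n + 1)) = u) then 1 else 0

lemma emb_ap {n : ℕ} (x y z : Fin n) :
    (((z : ℕ) : ZMod (2 * n + 1)) = 2 * ((y : ℕ) : ZMod (2 * n + 1)) - ((x : ℕ) : ZMod (2 * n + 1)))
      ↔ (x : ℕ) + z = 2 * y := by
  rw [eq_sub_iff_add_eq]
  have : (((z : ℕ) : ZMod (2 * n + 1)) + ((x : ℕ) : ZMod (2 * n + 1)) = 2 * ((y : ℕ) : ZMod (2 * n + 1)))
    ↔ (((z + x : ℕ)) : ZMod (2 * n + 1)) = ((2 * y : ℕ) : ZMod (2 * n + 1)) := by push_cast; rfl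
  rw [this, ZMod.natCast_eq_natCast_iff']
  have := x.2; have := y.2; have := z.2
  rw [Nat.mod_eq_of_lt (by omega), Nat.mod_eq_of_lt (by omega)]
  omega

lemma indZ_norm {n : ℕ} (P : Finset (Fin n)) (u : ZMod (2 * n + 1)) : ‖indZ P u‖ ≤ 1 := by
  have : indZ P u = ((P.filter (fun x : Fin n => (((x : ℕ) : ZMod (2 * n + 1)) = u))).card : ℂ) := by
    rw [indZ, Finset.sum_boole]
  rw [this, Complex.norm_natCast]
  have : (P.filter (fun x : Fin n => (((x : ℕ) : ZMod (2 * n + 1)) = u))).card ≤ 1 := by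
    rw [Finset.card_le_one]
    intro a ha b hb
    have h := (mem_filter.mp ha).2.trans (mem_filter.mp hb).2.symm
    rw [ZMod.natCast_eq_natCast_iff'] at h
    have := a.2; have := b.2
    rw [Nat.mod_eq_of_lt (by omega), Nat.mod_eq_of_lt (by omega)] at h
    exact Fin.ext h
  exact_mod_cast this

lemma tcount_indZ {n : ℕ} (P Q R : Finset (Fin n)) :
    tcount (indZ P) (indZ Q) (indZ R) =
      (((apT n).filter (fun p => p.1 ∈ P ∧ p.2.1 ∈ Q ∧ p.2.2 ∈ R)).card : ℂ) := by
  have h1 : tcount (indZ P) (indZ Q) (indZ R) = ∑ x ∈ P, ∑ y ∈ Q, ∑ z ∈ R,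
      (if (x : ℕ) + z = 2 * y then (1:ℂ) else 0) := by
    have : ∀ (P : Finset (Fin n)) (F : ZMod (2*n+1) → ℂ), ∑ u, indZ P u * F u =
        ∑ x ∈ P, F ((x : ℕ) : ZMod (2 * n + 1)) := by
      intro P F
      simp only [indZ, Finset.sum_mul]
      rw [Finset.sum_comm]
      refine Finset.sum_congr rfl fun x _ => ?_
      simp
    unfold tcount
    simp_rw [mul_assoc, ← Finset.mul_sum]
    rw [this P (fun u => ∑ v, indZ Q v * indZ R (2 * v - u))]
    refine Finset.sum_congr rfl fun x _ => ?_
    rw [this Q (fun v => indZ R (2 * v - _))]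
    refine Finset.sum_congr rfl fun y _ => ?_
    rw [indZ]
    refine Finset.sum_congr rfl fun z _ => ?_
    simp only [emb_ap]
  rw [h1]
  have h2 : (apT n).filter (fun p => p.1 ∈ P ∧ p.2.1 ∈ Q ∧ p.2.2 ∈ R) =
      (P ×ˢ Q ×ˢ R).filter (fun p => (p.1 : ℕ) + p.2.2 = 2 * p.2.1) := by
    ext ⟨x, y, z⟩
    simp only [mem_filter, mem_apT, mem_product]
    tauto
  rw [h2, ← Finset.sum_boole, Finset.sum_product]
  refine Finset.sum_congr rfl fun x _ => ?_
  rw [Finset.sum_product]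

def RF {n r : ℕ} (A : Finset (Fin n)) (c : Fin n → Fin r) : Prop :=
  ∀ x ∈ A, ∀ y ∈ A, ∀ z ∈ A, (x : ℕ) + z = 2 * y → c x = c y ∨ c y = c z ∨ c x = c z

noncomputable def popL {n r : ℕ} (C : Finset (Fin n → Fin r)) (η : ℝ) (x : Fin n) : Finset (Fin r) :=
  univ.filter (fun v => η * C.card ≤ ((C.filter (fun c => c x = v)).card : ℝ))

lemma class_bound {n r : ℕ} (A : Finset (Fin n)) (C : Finset (Fin n → Fin r)) (hC : C.Nonempty)
    (s η : ℝ) (hs : 0 ≤ s) (hη : 0 ≤ η)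
    (hRF : ∀ c ∈ C, RF A c)
    (hclose : ∀ c ∈ C, ∀ c' ∈ C, ∀ i k, ‖fhat (indZ (A.filter (fun x => c x = i))) k -
      fhat (indZ (A.filter (fun x => c' x = i))) k‖ ≤ s)
    (i j k : Fin r) (hij : i ≠ j) (hjk : j ≠ k) (hik : i ≠ k) :
    (((apT n).filter (fun p => (p.1 ∈ A ∧ p.2.1 ∈ A ∧ p.2.2 ∈ A) ∧
      i ∈ popL C η p.1 ∧ j ∈ popL C η p.2.1 ∧ k ∈ popL C η p.2.2)).card : ℝ) * η ^ 3
      ≤ 2 * s * (2 * n + 1 : ℕ) := by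
  classical
  have hodd : Odd (2 * n + 1) := ⟨n, rfl⟩
  have h1 : ∀ c1 ∈ C, ∀ c2 ∈ C, ∀ c3 ∈ C,
      (((apT n).filter (fun p => p.1 ∈ A.filter (fun x => c1 x = i) ∧
        p.2.1 ∈ A.filter (fun x => c2 x = j) ∧ p.2.2 ∈ A.filter (fun x => c3 x = k))).card : ℝ)
        ≤ 2 * s * (2 * n + 1 : ℕ) := by
    intro c1 h1 c2 h2 c3 h3
    have := tcount_close hodd (indZ (A.filter (fun x => c1 x = i)))
      (indZ (A.filter (fun x => c1 x = j))) (indZ (A.filter (fun x => c1 x = k)))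
      (indZ (A.filter (fun x => c2 x = j))) (indZ (A.filter (fun x => c3 x = k))) s hs
      (hclose c1 h1 c2 h2 j) (hclose c1 h1 c3 h3 k) (indZ_norm _) (indZ_norm _) (indZ_norm _) ?_
    · rw [tcount_indZ, Complex.norm_natCast] at this
      exact this
    · rw [tcount_indZ, Nat.cast_eq_zero, Finset.card_eq_zero, Finset.filter_eq_empty_iff]
      rintro ⟨x, y, z⟩ hp ⟨hx, hy, hz⟩
      rw [mem_apT] at hp
      simp only [mem_filter] at hx hy hz
      have := hRF c1 h1 x hx.1 y hy.1 z hz.1 hp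
      rw [hx.2, hy.2, hz.2] at this
      tauto
  set T := (apT n).filter (fun p => (p.1 ∈ A ∧ p.2.1 ∈ A ∧ p.2.2 ∈ A) ∧
      i ∈ popL C η p.1 ∧ j ∈ popL C η p.2.1 ∧ k ∈ popL C η p.2.2) with hT
  have hC0 : (0:ℝ) < C.card := by exact_mod_cast hC.card_pos
  -- total count
  have up : ∑ c1 ∈ C, ∑ c2 ∈ C, ∑ c3 ∈ C,
      (((apT n).filter (fun p => p.1 ∈ A.filter (fun x => c1 x = i) ∧
        p.2.1 ∈ A.filter (fun x => c2 x = j) ∧ p.2.2 ∈ A.filter (fun x => c3 x = k))).card : ℝ)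
        ≤ (C.card:ℝ)^3 * (2 * s * (2 * n + 1 : ℕ)) := by
    calc _ ≤ ∑ c1 ∈ C, ∑ c2 ∈ C, ∑ c3 ∈ C, (2 * s * (2 * n + 1 : ℕ)) := by
          refine Finset.sum_le_sum fun c1 m1 => Finset.sum_le_sum fun c2 m2 =>
            Finset.sum_le_sum fun c3 m3 => h1 c1 m1 c2 m2 c3 m3
      _ = _ := by simp only [Finset.sum_const, nsmul_eq_mul]; ring
  have eq : ∑ p ∈ T, ((C.filter (fun c => c p.1 = i)).card : ℝ) *
      (C.filter (fun c => c p.2.1 = j)).card * (C.filter (fun c => c p.2.2 = k)).card ≤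
      ∑ c1 ∈ C, ∑ c2 ∈ C, ∑ c3 ∈ C,
      (((apT n).filter (fun p => p.1 ∈ A.filter (fun x => c1 x = i) ∧
        p.2.1 ∈ A.filter (fun x => c2 x = j) ∧ p.2.2 ∈ A.filter (fun x => c3 x = k))).card : ℝ) := by
    calc _ = ∑ p ∈ T, ∑ c1 ∈ C, ∑ c2 ∈ C, ∑ c3 ∈ C,
          (if c1 p.1 = i ∧ c2 p.2.1 = j ∧ c3 p.2.2 = k then (1:ℝ) else 0) := by
          refine Finset.sum_congr rfl fun p _ => ?_
          rw [← Finset.sum_boole, ← Finset.sum_boole, ← Finset.sum_boole, Finset.sum_mul_sum,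
            Finset.sum_mul]
          refine Finset.sum_congr rfl fun c1 _ => ?_
          rw [Finset.sum_mul]
          refine Finset.sum_congr rfl fun c2 _ => ?_
          rw [Finset.mul_sum]
          refine Finset.sum_congr rfl fun c3 _ => ?_
          by_cases e1 : c1 p.1 = i <;> by_cases e2 : c2 p.2.1 = j <;> by_cases e3 : c3 p.2.2 = k <;>
            simp [e1, e2, e3]
      _ = ∑ c1 ∈ C, ∑ c2 ∈ C, ∑ c3 ∈ C, ∑ p ∈ T,
          (if c1 p.1 = i ∧ c2 p.2.1 = j ∧ c3 p.2.2 = k then (1:ℝ) else 0) := by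
          rw [Finset.sum_comm]
          refine Finset.sum_congr rfl fun c1 _ => ?_
          rw [Finset.sum_comm]
          refine Finset.sum_congr rfl fun c2 _ => ?_
          rw [Finset.sum_comm]
      _ ≤ _ := by
          refine Finset.sum_le_sum fun c1 m1 => Finset.sum_le_sum fun c2 m2 =>
            Finset.sum_le_sum fun c3 m3 => ?_
          rw [Finset.sum_boole]
          have : (T.filter (fun p => c1 p.1 = i ∧ c2 p.2.1 = j ∧ c3 p.2.2 = k)) ⊆
            ((apT n).filter (fun p => p.1 ∈ A.filter (fun x => c1 x = i) ∧
              p.2.1 ∈ A.filter (fun x => c2 x = j) ∧ p.2.2 ∈ A.filter (fun x => c3 x = k))) := by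
            intro p hp
            simp only [hT, mem_filter] at hp ⊢
            tauto
          exact_mod_cast Finset.card_le_card this
  have low : (T.card : ℝ) * (η * C.card)^3 ≤ ∑ p ∈ T, ((C.filter (fun c => c p.1 = i)).card : ℝ) *
      (C.filter (fun c => c p.2.1 = j)).card * (C.filter (fun c => c p.2.2 = k)).card := by
    rw [← nsmul_eq_mul, ← Finset.sum_const]
    apply Finset.sum_le_sum
    intro p hp
    simp only [hT, popL, mem_filter, mem_univ, true_and] at hp
    obtain ⟨_, _, a1, a2, a3⟩ := hp
    have : 0 ≤ η * C.card := by positivity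
    calc (η * C.card)^3 = (η * C.card) * (η * C.card) * (η * C.card) := by ring
      _ ≤ _ := by gcongr
  have fin := low.trans (eq.trans up)
  have : (C.card:ℝ)^3 * (T.card * η^3) ≤ (C.card:ℝ)^3 * (2 * s * (2 * n + 1 : ℕ)) := by
    calc _ = (T.card : ℝ) * (η * C.card)^3 := by ring
      _ ≤ _ := fin
  exact le_of_mul_le_mul_left this (by positivity)



lemma sdr3 {V : Type*} [DecidableEq V] (P Q R : Finset V) (hP : 3 ≤ P.card) (hQ : 3 ≤ Q.card)
    (hR : 3 ≤ R.card) : ∃ i ∈ P, ∃ j ∈ Q, ∃ k ∈ R, i ≠ j ∧ j ≠ k ∧ i ≠ k := by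
  obtain ⟨i, hi⟩ := Finset.card_pos.mp (by omega : 0 < P.card)
  obtain ⟨j, hj⟩ := Finset.card_pos.mp (by
    have := Finset.le_card_sdiff {i} Q; simp at this; omega : 0 < (Q \ {i}).card)
  obtain ⟨k, hk⟩ := Finset.card_pos.mp (by
    have := Finset.le_card_sdiff {i, j} R
    have := Finset.card_le_two (a := i) (b := j); omega : 0 < (R \ {i, j}).card)
  simp only [mem_sdiff, mem_singleton, mem_insert, not_or] at hj hk
  exact ⟨i, hi, j, hj.1, k, hk.1, fun h => hj.2 h.symm, fun h => hk.2.2 h.symm, fun h => hk.2.1 h.symm⟩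

lemma sdr2_aux {V : Type*} [DecidableEq V] (P Q R : Finset V) (hP : P.card = 2) (hQ : Q.card = 2)
    (hR : R.card = 2) (h : P ≠ Q) : ∃ i ∈ P, ∃ j ∈ Q, ∃ k ∈ R, i ≠ j ∧ j ≠ k ∧ i ≠ k := by
  have : ¬ P ⊆ Q := fun hs => h (Finset.eq_of_subset_of_card_le hs (by omega))
  obtain ⟨i, hi, hiQ⟩ := Finset.not_subset.mp this
  obtain ⟨k, hk⟩ := Finset.card_pos.mp (by
    have := Finset.le_card_sdiff {i} R; simp at this; omega : 0 < (R \ {i}).card)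
  obtain ⟨j, hj⟩ := Finset.card_pos.mp (by
    have := Finset.le_card_sdiff {k} Q; simp at this; omega : 0 < (Q \ {k}).card)
  simp only [mem_sdiff, mem_singleton] at hj hk
  exact ⟨i, hi, j, hj.1, k, hk.1, fun h => hiQ (h ▸ hj.1), hj.2, fun h => hk.2 h.symm⟩

lemma sdr2 {V : Type*} [DecidableEq V] (P Q R : Finset V) (hP : P.card = 2) (hQ : Q.card = 2)
    (hR : R.card = 2) (h : ¬ (Q = P ∧ R = P)) :
    ∃ i ∈ P, ∃ j ∈ Q, ∃ k ∈ R, i ≠ j ∧ j ≠ k ∧ i ≠ k := by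
  by_cases hPQ : P = Q
  · have : P ≠ R := fun e => h ⟨hPQ.symm, e.symm⟩
    obtain ⟨i, hi, k, hk, j, hj, a, b, c⟩ := sdr2_aux P R Q hP hR hQ this
    exact ⟨i, hi, j, hj, k, hk, c, b.symm, a⟩
  · exact sdr2_aux P Q R hP hQ hR hPQ

/-- progressions with a rainbow choice of colors from the lists -/
def rbw {n r : ℕ} (A : Finset (Fin n)) (L : Fin n → Finset (Fin r)) :
    Finset (Fin n × Fin n × Fin n) :=
  (apT n).filter (fun p => (p.1 ∈ A ∧ p.2.1 ∈ A ∧ p.2.2 ∈ A) ∧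
    ∃ i ∈ L p.1, ∃ j ∈ L p.2.1, ∃ k ∈ L p.2.2, i ≠ j ∧ j ≠ k ∧ i ≠ k)

lemma rbw_card {n r : ℕ} (A : Finset (Fin n)) (L : Fin n → Finset (Fin r)) (G : ℝ) (hG : 0 ≤ G)
    (h : ∀ i j k : Fin r, i ≠ j → j ≠ k → i ≠ k →
      (((apT n).filter (fun p => (p.1 ∈ A ∧ p.2.1 ∈ A ∧ p.2.2 ∈ A) ∧
        i ∈ L p.1 ∧ j ∈ L p.2.1 ∧ k ∈ L p.2.2)).card : ℝ) ≤ G) :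
    ((rbw A L).card : ℝ) ≤ (r:ℝ)^3 * G := by
  classical
  have hs : rbw A L ⊆ (univ : Finset (Fin r × Fin r × Fin r)).biUnion (fun q =>
      if q.1 ≠ q.2.1 ∧ q.2.1 ≠ q.2.2 ∧ q.1 ≠ q.2.2 then
      (apT n).filter (fun p => (p.1 ∈ A ∧ p.2.1 ∈ A ∧ p.2.2 ∈ A) ∧
        q.1 ∈ L p.1 ∧ q.2.1 ∈ L p.2.1 ∧ q.2.2 ∈ L p.2.2) else ∅) := by
    intro p hp
    simp only [rbw, mem_filter] at hp
    obtain ⟨h1, h2, i, hi, j, hj, k, hk, hne⟩ := hp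
    rw [mem_biUnion]
    refine ⟨(i, j, k), mem_univ _, ?_⟩
    rw [if_pos hne, mem_filter]
    exact ⟨h1, h2, hi, hj, hk⟩
  have h1 := (Finset.card_le_card hs).trans Finset.card_biUnion_le
  have h2 : ((rbw A L).card : ℝ) ≤ ∑ q : Fin r × Fin r × Fin r, G := by
    refine (Nat.cast_le (α := ℝ).mpr h1).trans ?_
    rw [Nat.cast_sum]
    apply Finset.sum_le_sum
    intro q _
    split_ifs with hq
    · exact h _ _ _ hq.1 hq.2.1 hq.2.2
    · simpa using hG
  refine h2.trans (le_of_eq ?_)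
  simp only [Finset.sum_const, nsmul_eq_mul, card_univ, Fintype.card_prod, Fintype.card_fin]
  push_cast; ring

def badT {n r : ℕ} (L : Fin n → Finset (Fin r)) : Finset (Fin n × Fin n × Fin n) :=
  (apT n).filter (fun p => ¬ ((L p.1).card = 2 ∧ L p.2.1 = L p.1 ∧ L p.2.2 = L p.1))

lemma badT_card {n r : ℕ} (A : Finset (Fin n)) (L : Fin n → Finset (Fin r))
    (hA : ∀ x, 2 ≤ (L x).card → x ∈ A) :
    (badT L).card ≤ (rbw A L).card + 3 * ((univ.filter (fun x => (L x).card ≠ 2)).card * n) := by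
  classical
  set Q := univ.filter (fun x => (L x).card ≠ 2) with hQ
  have hs : badT L ⊆ rbw A L ∪ ((apT n).filter (fun p => p.1 ∈ Q) ∪
      ((apT n).filter (fun p => p.2.1 ∈ Q) ∪ (apT n).filter (fun p => p.2.2 ∈ Q))) := by
    rintro ⟨x, y, z⟩ hp
    simp only [badT, mem_filter] at hp
    simp only [mem_union, mem_filter, rbw, hQ, mem_univ, true_and]
    by_cases h1 : (L x).card = 2
    · by_cases h2 : (L y).card = 2
      · by_cases h3 : (L z).card = 2
        · left
          refine ⟨hp.1, ⟨hA x h1.ge, hA y h2.ge, hA z h3.ge⟩, sdr2 _ _ _ h1 h2 h3 ?_⟩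
          intro h; exact hp.2 ⟨h1, h.1, h.2⟩
        · right; right; right; exact ⟨hp.1, h3⟩
      · right; right; left; exact ⟨hp.1, h2⟩
    · right; left; exact ⟨hp.1, h1⟩
  have c1 : ((apT n).filter (fun p => p.1 ∈ Q)).card ≤ Q.card * n := by
    have : ((apT n).filter (fun p => p.1 ∈ Q)).card ≤ (Q ×ˢ (univ : Finset (Fin n))).card := by
      apply Finset.card_le_card_of_injOn (fun p => (p.1, p.2.1))
      · rintro ⟨x, y, z⟩ h; simp at h ⊢; exact h.2
      · rintro ⟨x, y, z⟩ h ⟨x', y', z'⟩ h' he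
        simp only [coe_filter, mem_apT, Set.mem_ofPred_eq, Prod.mk.injEq] at h h' he
        obtain ⟨rfl, rfl⟩ := he
        have : z = z' := Fin.ext (by omega)
        rw [this]
    simpa using this
  have c2 : ((apT n).filter (fun p => p.2.1 ∈ Q)).card ≤ Q.card * n := by
    have : ((apT n).filter (fun p => p.2.1 ∈ Q)).card ≤ (Q ×ˢ (univ : Finset (Fin n))).card := by
      apply Finset.card_le_card_of_injOn (fun p => (p.2.1, p.1))
      · rintro ⟨x, y, z⟩ h; simp at h ⊢; exact h.2
      · rintro ⟨x, y, z⟩ h ⟨x', y', z'⟩ h' he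
        simp only [coe_filter, mem_apT, Set.mem_ofPred_eq, Prod.mk.injEq] at h h' he
        obtain ⟨rfl, rfl⟩ := he
        have : z = z' := Fin.ext (by omega)
        rw [this]
    simpa using this
  have c3 : ((apT n).filter (fun p => p.2.2 ∈ Q)).card ≤ Q.card * n := by
    have : ((apT n).filter (fun p => p.2.2 ∈ Q)).card ≤ (Q ×ˢ (univ : Finset (Fin n))).card := by
      apply Finset.card_le_card_of_injOn (fun p => (p.2.2, p.2.1))
      · rintro ⟨x, y, z⟩ h; simp at h ⊢; exact h.2
      · rintro ⟨x, y, z⟩ h ⟨x', y', z'⟩ h' he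
        simp only [coe_filter, mem_apT, Set.mem_ofPred_eq, Prod.mk.injEq] at h h' he
        obtain ⟨rfl, rfl⟩ := he
        have : x = x' := Fin.ext (by omega)
        rw [this]
    simpa using this
  have u1 := Finset.card_le_card hs
  have u2 := Finset.card_union_le (rbw A L) ((apT n).filter (fun p => p.1 ∈ Q) ∪
      ((apT n).filter (fun p => p.2.1 ∈ Q) ∪ (apT n).filter (fun p => p.2.2 ∈ Q)))
  have u3 := Finset.card_union_le ((apT n).filter (fun p => p.1 ∈ Q))
      ((apT n).filter (fun p => p.2.1 ∈ Q) ∪ (apT n).filter (fun p => p.2.2 ∈ Q))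
  have u4 := Finset.card_union_le ((apT n).filter (fun p => p.2.1 ∈ Q)) ((apT n).filter (fun p => p.2.2 ∈ Q))
  omega

lemma stab {n r : ℕ} (hn : 12 ≤ n) (L : Fin n → Finset (Fin r)) (β : ℝ) (hβ : 72 * β < 1)
    (hbad : ((badT L).card : ℝ) ≤ β * (n:ℝ)^2) :
    ∃ y, (L y).card = 2 ∧ ((univ.filter (fun x => L x ≠ L y)).card : ℝ) ≤ 72 * β * n := by
  classical
  let bp : Fin n → Fin n → Prop := fun u v => ¬ (L u = L v ∧ (L u).card = 2)
  have hw : ∀ (x y : Fin n) (t : Fin (n/12)), ∃ w : Fin n, (w : ℕ) =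
      if 2 * (y:ℕ) < n then (y:ℕ) + (2 * t + (x + y) % 2) else (y:ℕ) - (2 * t + (x + y) % 2) := by
    intro x y t
    have h1 := t.2
    have h2 := y.2
    have h3 : (if 2 * (y:ℕ) < n then (y:ℕ) + (2 * t + (x + y) % 2)
        else (y:ℕ) - (2 * t + (x + y) % 2)) < n := by
      split_ifs <;> omega
    exact ⟨⟨_, h3⟩, rfl⟩
  choose w hw using hw
  let F1 : Finset (Fin n × Fin n) := univ.filter (fun p => ((p.1 : ℕ) + p.2) % 2 = 0 ∧ bp p.1 p.2)
  let F2 : Finset (Fin n × Fin n) := univ.filter (fun p => ((p.1 : ℕ) ≤ 2 * p.2 ∧ 2 * (p.2:ℕ) - p.1 < n) ∧ bp p.1 p.2)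
  let F3 : Finset (Fin n × Fin n) := univ.filter (fun p => ((p.2 : ℕ) ≤ 2 * p.1 ∧ 2 * (p.1:ℕ) - p.2 < n) ∧ bp p.1 p.2)
  have hF1 : F1.card ≤ (badT L).card := by
    apply Finset.card_le_card_of_surjOn (fun p => (p.1, p.2.2))
    rintro ⟨u, v⟩ h
    simp only [F1, coe_filter, mem_univ, true_and, Set.mem_ofPred_eq] at h
    refine ⟨(u, ⟨((u:ℕ) + v) / 2, by omega⟩, v), ?_, rfl⟩
    simp only [badT, coe_filter, mem_apT, Set.mem_ofPred_eq]
    refine ⟨by omega, ?_⟩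
    rintro ⟨a, b, c⟩
    exact h.2 ⟨c.symm, a⟩
  have hF2 : F2.card ≤ (badT L).card := by
    apply Finset.card_le_card_of_surjOn (fun p => (p.1, p.2.1))
    rintro ⟨u, v⟩ h
    simp only [F2, coe_filter, mem_univ, true_and, Set.mem_ofPred_eq] at h
    refine ⟨(u, v, ⟨2 * (v:ℕ) - u, h.1.2⟩), ?_, rfl⟩
    simp only [badT, coe_filter, mem_apT, Set.mem_ofPred_eq]
    refine ⟨by omega, ?_⟩
    rintro ⟨a, b, c⟩
    exact h.2 ⟨b.symm, a⟩
  have hF3 : F3.card ≤ (badT L).card := by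
    apply Finset.card_le_card_of_surjOn (fun p => (p.2.1, p.1))
    rintro ⟨u, v⟩ h
    simp only [F3, coe_filter, mem_univ, true_and, Set.mem_ofPred_eq] at h
    refine ⟨(v, u, ⟨2 * (u:ℕ) - v, h.1.2⟩), ?_, rfl⟩
    simp only [badT, coe_filter, mem_apT, Set.mem_ofPred_eq]
    refine ⟨by omega, ?_⟩
    rintro ⟨a, b, c⟩
    exact h.2 ⟨b, b ▸ a⟩
  let BP : Finset (Fin n × Fin n) := univ.filter (fun p => bp p.1 p.2)
  have hBP : BP.card * (n / 12) ≤ F1.card * n + (F2.card * n + F3.card * n) := by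
    have : (BP ×ˢ (univ : Finset (Fin (n/12)))).card ≤
        ((F1 ×ˢ (univ : Finset (Fin n))).disjSum
          ((F2 ×ˢ (univ : Finset (Fin n))).disjSum (F3 ×ˢ (univ : Finset (Fin n))))).card := by
      apply Finset.card_le_card_of_injOn (fun q =>
        if (q.1.1, w q.1.1 q.1.2 q.2) ∈ F1 then Sum.inl ((q.1.1, w q.1.1 q.1.2 q.2), q.1.2)
        else if (w q.1.1 q.1.2 q.2, q.1.2) ∈ F2 then
          Sum.inr (Sum.inl ((w q.1.1 q.1.2 q.2, q.1.2), q.1.1))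
        else Sum.inr (Sum.inr ((w q.1.1 q.1.2 q.2, q.1.2), q.1.1)))
      · rintro ⟨⟨x, y⟩, t⟩ h
        simp only [coe_product, Set.mem_prod, mem_coe, BP, mem_filter, mem_univ, true_and, and_true] at h
        dsimp only
        split_ifs with h1 h2
        · simp [h1]
        · simp [h2]
        · simp only [mem_coe, inr_mem_disjSum, mem_product, mem_univ, and_true]
          simp only [F1, F2, F3, mem_filter, mem_univ, true_and] at h1 h2 ⊢
          have e := hw x y t
          have ht := t.2
          have hy := y.2
          have par : ((x:ℕ) + (w x y t : ℕ)) % 2 = 0 := by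
            rw [e]; split_ifs <;> omega
          have cl : ((w x y t : ℕ) ≤ 2 * y ∧ 2 * (y:ℕ) - w x y t < n) ∨
              ((y:ℕ) ≤ 2 * (w x y t : ℕ) ∧ 2 * (w x y t : ℕ) - y < n) := by
            rw [e]; split_ifs <;> omega
          have nb : L x = L (w x y t) ∧ (L x).card = 2 := by
            by_contra hh; exact h1 ⟨par, hh⟩
          have bw : bp (w x y t) y := by
            rintro ⟨a, b⟩
            exact h ⟨nb.1.trans a, nb.2⟩
          rcases cl with cl | cl
          · exact absurd ⟨cl, bw⟩ h2
          · exact ⟨cl, bw⟩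
      · rintro ⟨⟨x, y⟩, t⟩ h ⟨⟨x', y'⟩, t'⟩ h' he
        have fin : x = x' → y = y' → w x y t = w x' y' t' → (((x, y), t) : (Fin n × Fin n) × Fin (n/12)) = ((x', y'), t') := by
          rintro rfl rfl hww
          have e1 := hw x y t
          have e2 := hw x y t'
          rw [hww] at e1
          have := t.2; have := t'.2; have := y.2
          have : t = t' := by
            apply Fin.ext
            rw [e1] at e2
            split_ifs at e2 <;> omega
          rw [this]
        dsimp only at he
        split_ifs at he <;> simp only [Sum.inl.injEq, Sum.inr.injEq, Prod.mk.injEq, reduceCtorEq] at he <;>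
          exact fin (by tauto) (by tauto) (by tauto)
    simpa [card_disjSum] using this
  have hBP2 : (BP.card : ℝ) ≤ 72 * β * (n:ℝ)^2 := by
    have h1 : BP.card * (n/12) ≤ 3 * (badT L).card * n := by nlinarith
    have h2 : n ≤ 24 * (n / 12) := by omega
    have h3 : BP.card * n ≤ 72 * (badT L).card * n := by nlinarith
    have h4 : BP.card ≤ 72 * (badT L).card := Nat.le_of_mul_le_mul_right h3 (by omega)
    have h5 : (BP.card : ℝ) ≤ 72 * (badT L).card := by exact_mod_cast h4
    linarith
  have hn0 : (0:ℝ) < n := by exact_mod_cast (by omega : 0 < n)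
  have hex : ∃ y, ((univ.filter (fun x => bp x y)).card : ℝ) ≤ 72 * β * n := by
    by_contra hcon
    replace hcon := fun y => not_le.mp (not_exists.mp hcon y)
    have : (BP.card : ℝ) = ∑ y, ((univ.filter (fun x => bp x y)).card : ℝ) := by
      have : BP.card = ∑ y, (univ.filter (fun x => bp x y)).card := by
        simp only [BP, Finset.card_filter]
        rw [Fintype.sum_prod_type, Finset.sum_comm]
      rw [this]; push_cast; rfl
    have h2 : ∑ y : Fin n, (72 * β * n) < ∑ y, ((univ.filter (fun x => bp x y)).card : ℝ) := by
      apply Finset.sum_lt_sum_of_nonempty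
      · exact ⟨⟨0, by omega⟩, mem_univ _⟩
      · intro y _; exact hcon y
    simp at h2
    nlinarith
  obtain ⟨y, hy⟩ := hex
  have hx : ∃ x, ¬ bp x y := by
    by_contra hcon
    replace hcon := fun y => not_not.mp (not_exists.mp hcon y)
    have : (univ.filter (fun x => bp x y)) = univ := by
      ext x; simp [hcon x]
    rw [this, card_univ, Fintype.card_fin] at hy
    nlinarith
  obtain ⟨x, hx⟩ := hx
  simp only [bp, not_not] at hx
  refine ⟨y, by rw [← hx.1]; exact hx.2, le_trans ?_ hy⟩
  have : (univ.filter (fun x => L x ≠ L y)) ⊆ (univ.filter (fun x => bp x y)) := by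
    intro u hu
    simp only [mem_filter, mem_univ, true_and, bp] at hu ⊢
    tauto
  exact_mod_cast Finset.card_le_card this


lemma count_near_exp {X V : Type*} [Fintype X] [DecidableEq X] [Fintype V] [DecidableEq V]
    (L : X → Finset V) (S : Finset (X → V)) (t K : ℝ) (ht : 0 < t) (ht1 : t ≤ 1)
    (h : ∀ c ∈ S, ((univ.filter (fun x => c x ∉ L x)).card : ℝ) ≤ K)
    (w : X → ℝ) (hw : ∀ x, 0 ≤ w x) (hL : ∀ x, ((L x).card : ℝ) ≤ Real.exp (w x)) :
    (S.card : ℝ) ≤ Real.exp (K * Real.log (1 / t) + (∑ x, w x) + Fintype.card X * (t * Fintype.card V)) := by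
  refine (count_near L S t K ht ht1 h).trans ?_
  have h1 : ∀ x, ((L x).card + t * Fintype.card V : ℝ) ≤ Real.exp (w x) * Real.exp (t * Fintype.card V) := by
    intro x
    have h2 := Real.add_one_le_exp (t * Fintype.card V)
    have h3 := Real.one_le_exp (hw x)
    have h4 : (0:ℝ) ≤ t * Fintype.card V := by positivity
    have h5 := hL x
    nlinarith [Real.exp_pos (w x)]
  rw [add_assoc, Real.exp_add]
  apply mul_le_mul_of_nonneg_left _ (Real.exp_pos _).le
  refine (Finset.prod_le_prod (fun x _ => by positivity) (fun x _ => h1 x)).trans ?_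
  rw [Finset.prod_mul_distrib, ← Real.exp_sum, Real.exp_add]
  simp [← Real.exp_nat_mul]

lemma Zcard (n x0 : ℕ) (hn : 4 ≤ n) :
    (n:ℝ)/8 ≤ ((univ : Finset (Fin n)).filter (fun z : Fin n => (z:ℕ) % 4 = (x0 + 2) % 4)).card := by
  have h1 : n / 4 ≤ ((univ : Finset (Fin n)).filter (fun z : Fin n => (z:ℕ) % 4 = (x0 + 2) % 4)).card := by
    have : (range (n/4)).card ≤ ((univ : Finset (Fin n)).filter (fun z : Fin n => (z:ℕ) % 4 = (x0 + 2) % 4)).card := by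
      apply Finset.card_le_card_of_injOn
        (fun k => if h : 4 * k + (x0+2) % 4 < n then (⟨4 * k + (x0+2)%4, h⟩ : Fin n) else ⟨0, by omega⟩)
      · intro k hk
        simp only [coe_range, Set.mem_Iio] at hk
        have : 4 * k + (x0+2) % 4 < n := by omega
        simp only [dif_pos this, coe_filter, mem_univ, true_and, Set.mem_ofPred_eq]
        omega
      · intro k hk l hl hkl
        simp only [coe_range, Set.mem_Iio] at hk hl
        have h1 : 4 * k + (x0+2) % 4 < n := by omega
        have h2 : 4 * l + (x0+2) % 4 < n := by omega
        simp only [dif_pos h1, dif_pos h2, Fin.mk.injEq] at hkl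
        omega
    simpa using this
  have h2 : n ≤ 8 * (n/4) := by omega
  have h3 : (n:ℝ) ≤ 8 * ((n/4 : ℕ):ℝ) := by exact_mod_cast h2
  have h4 : ((n/4 : ℕ):ℝ) ≤ _ := Nat.cast_le.mpr h1
  linarith

lemma pair_count0 {n r : ℕ} (hn : 4 ≤ n) (A : Finset (Fin n)) (i j : Fin r) (x0 : Fin n) (hx0 : x0 ∈ A)
    (S : Finset (Fin n → Fin r)) (K t : ℝ) (ht : 0 < t) (ht1 : t ≤ 1)
    (hRF : ∀ c ∈ S, RF A c) (h3 : ∀ c ∈ S, c x0 ≠ i ∧ c x0 ≠ j)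
    (hK : ∀ c ∈ S, ((univ.filter (fun x => x ∉ A ∨ (c x ≠ i ∧ c x ≠ j))).card : ℝ) ≤ K) :
    (S.card : ℝ) ≤ Real.exp (2 * K * Real.log (1/t) + t * (r+1) * n + 7/8 * n * Real.log 2) := by
  classical
  set Z := (univ : Finset (Fin n)).filter (fun z : Fin n => (z:ℕ) % 4 = ((x0:ℕ) + 2) % 4) with hZ
  have hZm : ∀ z, z ∈ Z ↔ (z:ℕ) % 4 = ((x0:ℕ) + 2) % 4 := by intro z; simp [hZ]
  let p : Fin n → Fin n := fun z => ⟨((x0:ℕ) + z)/2, by omega⟩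
  have hp : ∀ z ∈ Z, (x0:ℕ) + z = 2 * (p z : ℕ) := by
    intro z hz; have := (hZm z).1 hz; simp only [p]; omega
  have hpZ : ∀ z ∈ Z, p z ∉ Z := by
    intro z hz h; have := (hZm z).1 hz; have := (hZm _).1 h; have := hp z hz; omega
  let enc : (Fin n → Fin r) → (Fin n → Option (Fin r)) := fun c x =>
    if x ∈ Z ∧ c x = c (p x) then none else some (c x)
  have hinj : Function.Injective enc := by
    intro c c' hcc
    have hoff : ∀ x, x ∉ Z → c x = c' x := by
      intro x hx
      have := congrFun hcc x
      simpa [enc, hx] using this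
    funext x
    by_cases hx : x ∈ Z
    · have h1 := congrFun hcc x
      have h2 := hoff _ (hpZ x hx)
      simp only [enc, hx, true_and] at h1
      split_ifs at h1 with ha hb
      · rw [ha, hb, h2]
      · simpa using h1
    · exact hoff x hx
  let L : Fin n → Finset (Option (Fin r)) := fun x => if x ∈ Z then {none} else {some i, some j}
  let w : Fin n → ℝ := fun x => if x ∈ Z then 0 else Real.log 2
  have hcard : (S.image enc).card = S.card := Finset.card_image_of_injective _ hinj
  have key := count_near_exp L (S.image enc) t (2*K) ht ht1 ?_ w ?_ ?_
  · rw [hcard] at key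
    refine key.trans (Real.exp_le_exp.mpr ?_)
    have hw : ∑ x, w x = (n - Z.card) * Real.log 2 := by
      simp only [w]
      rw [Finset.sum_ite]
      simp only [sum_const_zero, zero_add, sum_const, nsmul_eq_mul]
      congr 1
      have := Finset.card_filter_add_card_filter_not (s := (univ : Finset (Fin n))) (fun x => x ∈ Z)
      simp only [card_univ, Fintype.card_fin, filter_mem_eq_inter, univ_inter] at this
      rw [eq_sub_iff_add_eq, ← Nat.cast_add, add_comm, this]
    have hz := Zcard n x0 hn
    rw [hw]
    simp only [Fintype.card_fin, Fintype.card_option]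
    have hl : 0 < Real.log 2 := Real.log_pos (by norm_num)
    push_cast
    rw [← hZ] at hz
    nlinarith
  · intro c' hc'
    obtain ⟨c, hc, rfl⟩ := mem_image.mp hc'
    set E := (univ.filter (fun x => x ∉ A ∨ (c x ≠ i ∧ c x ≠ j))) with hE
    have hEm : ∀ x, x ∉ E → x ∈ A ∧ (c x = i ∨ c x = j) := by
      intro x hx
      simp only [hE, mem_filter, mem_univ, true_and] at hx
      tauto
    have hs : (univ.filter (fun x => enc c x ∉ L x)) ⊆ E ∪ (Z.filter (fun z => p z ∈ E)) := by
      intro x hx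
      simp only [mem_filter, mem_univ, true_and] at hx
      by_contra hcon
      simp only [mem_union, mem_filter, not_or, not_and] at hcon
      obtain ⟨h1, h2⟩ := hcon
      by_cases hxZ : x ∈ Z
      · have ha := hEm x h1
        have hb := hEm _ (h2 hxZ)
        have h3c := h3 c hc
        have := hRF c hc x0 hx0 (p x) hb.1 x ha.1 (hp x hxZ)
        have he : c x = c (p x) := by
          rcases this with h | h | h
          · rcases hb.2 with h' | h' <;> simp_all
          · exact h.symm
          · rcases ha.2 with h' | h' <;> simp_all
        apply hx
        simp [enc, L, hxZ, he]
      · have ha := hEm x h1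
        apply hx
        simp [enc, L, hxZ, ha.2]
    have h1 := (Finset.card_le_card hs).trans (Finset.card_union_le _ _)
    have h2 : (Z.filter (fun z => p z ∈ E)).card ≤ E.card := by
      apply Finset.card_le_card_of_injOn p
      · intro z hz
        simp only [coe_filter, Set.mem_ofPred_eq] at hz
        exact hz.2
      · intro z hz z' hz' hzz
        simp only [coe_filter, Set.mem_ofPred_eq] at hz hz'
        have a1 := hp z hz.1
        have a2 := hp z' hz'.1
        rw [hzz] at a1
        apply Fin.ext; omega
    have h4 := hK c hc
    have h5 : (((univ.filter (fun x => enc c x ∉ L x)).card : ℕ) : ℝ) ≤ ((2 * E.card : ℕ) : ℝ) := by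
      apply Nat.cast_le.mpr; omega
    push_cast at h5
    linarith
  · intro x; simp only [w]; split_ifs
    · exact le_rfl
    · exact Real.log_nonneg (by norm_num)
  · intro x
    simp only [w, L]; split_ifs
    · simp
    · rw [Real.exp_log (by norm_num)]
      exact_mod_cast Finset.card_le_two

lemma pair_count {n r : ℕ} (hn : 4 ≤ n) (A : Finset (Fin n)) (i j : Fin r)
    (S : Finset (Fin n → Fin r)) (K t : ℝ) (ht : 0 < t) (ht1 : t ≤ 1)
    (hRF : ∀ c ∈ S, RF A c) (h3 : ∀ c ∈ S, ∃ x ∈ A, c x ≠ i ∧ c x ≠ j)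
    (hK : ∀ c ∈ S, ((univ.filter (fun x => x ∉ A ∨ (c x ≠ i ∧ c x ≠ j))).card : ℝ) ≤ K) :
    (S.card : ℝ) ≤ n * Real.exp (2 * K * Real.log (1/t) + t * (r+1) * n + 7/8 * n * Real.log 2) := by
  classical
  have hs : S ⊆ (univ : Finset (Fin n)).biUnion (fun x0 => S.filter (fun c => x0 ∈ A ∧ c x0 ≠ i ∧ c x0 ≠ j)) := by
    intro c hc
    obtain ⟨x, hx, h⟩ := h3 c hc
    rw [mem_biUnion]
    exact ⟨x, mem_univ _, mem_filter.mpr ⟨hc, hx, h⟩⟩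
  have h1 := (Finset.card_le_card hs).trans Finset.card_biUnion_le
  refine (Nat.cast_le (α := ℝ).mpr h1).trans ?_
  push_cast
  refine (Finset.sum_le_card_nsmul _ _ (Real.exp (2 * K * Real.log (1/t) + t * (r+1) * n + 7/8 * n * Real.log 2)) ?_).trans (by simp)
  intro x0 _
  by_cases hx0 : x0 ∈ A
  · apply pair_count0 hn A i j x0 hx0 _ K t ht ht1
    · intro c hc; exact hRF c (mem_filter.mp hc).1
    · intro c hc; exact (mem_filter.mp hc).2.2
    · intro c hc; exact hK c (mem_filter.mp hc).1
  · simp only [hx0, false_and, filter_false, card_empty, Nat.cast_zero]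
    exact (Real.exp_pos _).le

lemma nonpair_count {n r : ℕ} (hr : 3 ≤ r) (L : Fin n → Finset (Fin r))
    (S : Finset (Fin n → Fin r)) (K t : ℝ) (ht : 0 < t) (ht1 : t ≤ 1)
    (hK : ∀ c ∈ S, ((univ.filter (fun x => c x ∉ L x)).card : ℝ) ≤ K) :
    (S.card : ℝ) ≤ Real.exp (K * Real.log (1/t) + t * r * n +
      (n - ((univ.filter (fun x => (L x).card ≤ 1)).card : ℝ)) * Real.log 2 +
      ((univ.filter (fun x => 3 ≤ (L x).card)).card : ℝ) * Real.log r) := by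
  let w : Fin n → ℝ := fun x => (if (L x).card ≤ 1 then 0 else Real.log 2) + (if 3 ≤ (L x).card then Real.log r else 0)
  have hl2 : 0 ≤ Real.log 2 := Real.log_nonneg (by norm_num)
  have hlr : 0 ≤ Real.log r := Real.log_nonneg (by exact_mod_cast (by omega : 1 ≤ r))
  have hr0 : (0:ℝ) < r := by exact_mod_cast (by omega : 0 < r)
  refine (count_near_exp L S t K ht ht1 hK w ?_ ?_).trans (Real.exp_le_exp.mpr ?_)
  · intro x; simp only [w]; split_ifs <;> linarith
  · intro x; simp only [w]; split_ifs with h1 h2 h2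
    · omega
    · simpa using h1
    · rw [Real.exp_add, Real.exp_log (by norm_num), Real.exp_log hr0]
      have : (L x).card ≤ r := by simpa using Finset.card_le_univ (L x)
      have : ((L x).card:ℝ) ≤ r := by exact_mod_cast this
      linarith
    · rw [add_zero, Real.exp_log (by norm_num)]
      exact_mod_cast (by omega : (L x).card ≤ 2)
  · have hw : ∑ x, w x = (n - ((univ.filter (fun x => (L x).card ≤ 1)).card : ℝ)) * Real.log 2 +
      ((univ.filter (fun x => 3 ≤ (L x).card)).card : ℝ) * Real.log r := by
      simp only [w]
      rw [Finset.sum_add_distrib, Finset.sum_ite, Finset.sum_ite]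
      simp only [sum_const_zero, zero_add, add_zero, sum_const, nsmul_eq_mul]
      congr 2
      have := Finset.card_filter_add_card_filter_not (s := (univ : Finset (Fin n))) (fun x => (L x).card ≤ 1)
      simp only [card_univ, Fintype.card_fin] at this
      rw [eq_sub_iff_add_eq, ← Nat.cast_add, add_comm, this]
    rw [hw]; simp only [Fintype.card_fin]
    nlinarith


lemma markov {n r : ℕ} (hn : 0 < n) (hr : 0 < r) (C : Finset (Fin n → Fin r)) (η : ℝ) (hη : 0 < η) :
    ∃ C' ⊆ C, (C.card : ℝ) ≤ 2 * C'.card ∧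
      ∀ c ∈ C', ((univ.filter (fun x => c x ∉ popL C η x)).card : ℝ) ≤ 2 * r * η * n := by
  classical
  let bad : (Fin n → Fin r) → ℝ := fun c => ((univ.filter (fun x => c x ∉ popL C η x)).card : ℝ)
  have hsum : ∑ c ∈ C, bad c ≤ n * (r * (η * C.card)) := by
    have e1 : ∀ c, bad c = ∑ x : Fin n, ∑ v : Fin r, (if c x = v ∧ v ∉ popL C η x then (1:ℝ) else 0) := by
      intro c
      simp only [bad]
      rw [Finset.card_filter]
      push_cast
      apply Finset.sum_congr rfl
      intro x _
      rw [Finset.sum_eq_single (c x)]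
      · simp
      · intro v _ hv; rw [if_neg]; exact fun h => hv h.1.symm
      · simp
    simp_rw [e1]
    rw [Finset.sum_comm]
    have : ∀ x ∈ (univ : Finset (Fin n)), ∑ c ∈ C, ∑ v : Fin r, (if c x = v ∧ v ∉ popL C η x then (1:ℝ) else 0)
        ≤ r * (η * C.card) := by
      intro x _
      rw [Finset.sum_comm]
      refine (Finset.sum_le_card_nsmul _ _ (η * C.card) ?_).trans (by simp)
      intro v _
      by_cases hv : v ∈ popL C η x
      · simp only [hv, not_true_eq_false, and_false, if_false, sum_const_zero]; positivity
      · simp only [hv, not_false_eq_true, and_true]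
        rw [Finset.sum_boole]
        simp only [popL, mem_filter, mem_univ, true_and, not_le] at hv
        exact hv.le
    refine (Finset.sum_le_card_nsmul _ _ _ this).trans (by simp)
  refine ⟨C.filter (fun c => bad c ≤ 2 * r * η * n), Finset.filter_subset _ _, ?_, ?_⟩
  · have h1 := Finset.card_filter_add_card_filter_not (s := C) (fun c => bad c ≤ 2 * r * η * n)
    set P := C.filter (fun c => bad c ≤ 2 * r * η * n)
    set Q := C.filter (fun c => ¬ bad c ≤ 2 * r * η * n) with hQ
    have h2 : (Q.card : ℝ) * (2 * r * η * n) ≤ n * (r * (η * C.card)) := by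
      refine le_trans ?_ hsum
      refine le_trans ?_ (Finset.sum_le_sum_of_subset_of_nonneg (Finset.filter_subset (fun c => ¬ bad c ≤ 2 * r * η * n) C)
        (fun c _ _ => Nat.cast_nonneg _))
      rw [← nsmul_eq_mul]
      apply Finset.card_nsmul_le_sum
      intro c hc
      have := (mem_filter.mp hc).2
      linarith
    have hpos : (0:ℝ) < r * η * n := by
      have : (0:ℝ) < r := by exact_mod_cast hr
      have : (0:ℝ) < n := by exact_mod_cast hn
      positivity
    have h3 : (P.card : ℝ) + Q.card = C.card := by exact_mod_cast h1
    have h4 : 2 * (Q.card : ℝ) ≤ C.card := by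
      by_contra hcon
      push Not at hcon
      nlinarith
    linarith
  · intro c hc
    exact (mem_filter.mp hc).2

lemma popL_out {n r : ℕ} (A : Finset (Fin n)) (C : Finset (Fin n → Fin r)) (hC : C.Nonempty) (η : ℝ) (hη : 0 < η)
    (z0 : Fin r) (h0 : ∀ c ∈ C, ∀ x, x ∉ A → c x = z0) (x : Fin n) (hx : 2 ≤ (popL C η x).card) : x ∈ A := by
  classical
  by_contra hxA
  have : popL C η x ⊆ {z0} := by
    intro v hv
    simp only [popL, mem_filter, mem_univ, true_and] at hv
    rw [mem_singleton]
    by_contra hne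
    have he : C.filter (fun c => c x = v) = ∅ := by
      apply Finset.filter_eq_empty_iff.mpr
      intro c hc h
      exact hne (h.symm.trans (h0 c hc x hxA))
    rw [he] at hv
    have : (0:ℝ) < C.card := by exact_mod_cast hC.card_pos
    simp only [card_empty, Nat.cast_zero] at hv
    nlinarith
  have := Finset.card_le_card this
  simp at this
  omega

set_option maxHeartbeats 2000000 in
lemma class_lemma {n r : ℕ} (hr : 3 ≤ r) (hn : 12 ≤ n) (A : Finset (Fin n)) (C : Finset (Fin n → Fin r))
    (hC : C.Nonempty) (η γ ε1 ε2 k1 t1 t2 κ cv : ℝ) (z0 : Fin r)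
    (hη : 0 < η) (hγ : 0 ≤ γ) (hε1 : 0 < ε1) (hε2 : 0 < ε2)
    (ht1 : 0 < t1) (ht1' : t1 ≤ 1) (ht2 : 0 < t2) (ht2' : t2 ≤ 1)
    (hRF : ∀ c ∈ C, RF A c) (h0 : ∀ c ∈ C, ∀ x, x ∉ A → c x = z0)
    (h3 : ∀ c ∈ C, ∀ i j, ∃ x ∈ A, c x ≠ i ∧ c x ≠ j)
    (hbd : ∀ i j k : Fin r, i ≠ j → j ≠ k → i ≠ k →
      (((apT n).filter (fun p => (p.1 ∈ A ∧ p.2.1 ∈ A ∧ p.2.2 ∈ A) ∧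
        i ∈ popL C η p.1 ∧ j ∈ popL C η p.2.1 ∧ k ∈ popL C η p.2.2)).card : ℝ) ≤ γ * (n:ℝ)^2)
    (hvar : ∀ B : Finset (Fin n), ε2 * n ≤ B.card → cv * (n:ℝ)^2 ≤
      ((apT n).filter (fun p => p.1 ∈ B ∧ p.2.1 ∈ B ∧ p.2.2 ∈ B)).card)
    (hcv : (r:ℝ)^3 * γ < cv)
    (hk : 2 * r * η + 72 * (r^3 * γ + 3 * (ε1 + ε2)) ≤ k1) (hk1 : k1 ≤ 1/2)
    (hp1 : t1 * (r + 1) ≤ 0.01) (hp2 : 2 * k1 * Real.log (1/t1) ≤ 0.01)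
    (hq1 : ε2 * Real.log r ≤ ε1 * Real.log 2 / 4) (hq2 : t2 * r ≤ ε1 * Real.log 2 / 4)
    (hq3 : 2 * r * η * Real.log (1/t2) ≤ ε1 * Real.log 2 / 4)
    (hκ1 : κ ≤ 0.06) (hκ2 : κ ≤ ε1 * Real.log 2 / 4) :
    (C.card : ℝ) ≤ 2 * n * Real.exp (n * (Real.log 2 - κ)) := by
  classical
  have hn0 : (12:ℝ) ≤ n := by exact_mod_cast hn
  have hr0 : (3:ℝ) ≤ r := by exact_mod_cast hr
  obtain ⟨C', hC'C, hCC', hbad⟩ := markov (by omega) (by omega) C η hη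
  set L := popL C η with hL
  have hA : ∀ x, 2 ≤ (L x).card → x ∈ A := fun x hx => popL_out A C hC η hη z0 h0 x hx
  have hrbw : ((rbw A L).card : ℝ) ≤ (r:ℝ)^3 * (γ * (n:ℝ)^2) :=
    rbw_card A L _ (by positivity) hbd
  set a := (univ.filter (fun x => (L x).card ≤ 1)).card with ha
  set B := (univ.filter (fun x => 3 ≤ (L x).card)) with hB
  have hb : (B.card : ℝ) ≤ ε2 * n := by
    by_contra hcon
    push Not at hcon
    have h1 := hvar B hcon.le
    have h2 : (apT n).filter (fun p => p.1 ∈ B ∧ p.2.1 ∈ B ∧ p.2.2 ∈ B) ⊆ rbw A L := by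
      intro p hp
      simp only [mem_filter, hB, mem_univ, true_and] at hp
      obtain ⟨hp0, q1, q2, q3⟩ := hp
      simp only [rbw, mem_filter]
      exact ⟨hp0, ⟨hA _ (by omega), hA _ (by omega), hA _ (by omega)⟩, sdr3 _ _ _ q1 q2 q3⟩
    have h3 : (((apT n).filter (fun p => p.1 ∈ B ∧ p.2.1 ∈ B ∧ p.2.2 ∈ B)).card : ℝ) ≤ (rbw A L).card :=
      Nat.cast_le.mpr (Finset.card_le_card h2)
    have h4 : (0:ℝ) < (n:ℝ)^2 := by positivity
    nlinarith
  have hl2 : 0 < Real.log 2 := Real.log_pos (by norm_num)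
  have hlr : 0 ≤ Real.log r := Real.log_nonneg (by linarith)
  have hE := Real.exp_pos (n * (Real.log 2 - κ))
  by_cases hcase : ε1 * n ≤ a
  · have h1 := nonpair_count hr L C' (2 * r * η * n) t2 ht2 ht2' hbad
    have h2 : (C'.card : ℝ) ≤ Real.exp (n * (Real.log 2 - κ)) := by
      refine h1.trans (Real.exp_le_exp.mpr ?_)
      have e1 : 2 * r * η * n * Real.log (1/t2) ≤ (ε1 * Real.log 2 / 4) * n := by
        have := mul_le_mul_of_nonneg_right hq3 (by linarith : (0:ℝ) ≤ n); linarith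
      have e2 : t2 * r * n ≤ (ε1 * Real.log 2 / 4) * n := by gcongr
      have e3 : (B.card : ℝ) * Real.log r ≤ (ε1 * Real.log 2 / 4) * n := by
        have := mul_le_mul_of_nonneg_right hb hlr
        have := mul_le_mul_of_nonneg_right hq1 (by linarith : (0:ℝ) ≤ n); linarith
      have e4 : ε1 * n * Real.log 2 ≤ a * Real.log 2 := by gcongr
      have e5 : κ * n ≤ (ε1 * Real.log 2 / 4) * n := by gcongr
      linarith
    nlinarith
  · push Not at hcase
    have hne2 : ((univ.filter (fun x => (L x).card ≠ 2)).card : ℝ) ≤ (ε1 + ε2) * n := by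
      have hs : (univ.filter (fun x => (L x).card ≠ 2)) ⊆ (univ.filter (fun x => (L x).card ≤ 1)) ∪ B := by
        intro x hx
        simp only [mem_filter, mem_univ, true_and, mem_union, hB] at hx ⊢
        omega
      have := (Finset.card_le_card hs).trans (Finset.card_union_le _ _)
      have : ((univ.filter (fun x => (L x).card ≠ 2)).card : ℝ) ≤ a + B.card := by exact_mod_cast this
      linarith
    set β := (r:ℝ)^3 * γ + 3 * (ε1 + ε2) with hβ
    have hbt : ((badT L).card : ℝ) ≤ β * (n:ℝ)^2 := by
      have h1 := badT_card A L hA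
      have h2 : ((badT L).card : ℝ) ≤ (rbw A L).card + 3 * ((univ.filter (fun x => (L x).card ≠ 2)).card * n) := by
        exact_mod_cast h1
      have h3 := mul_le_mul_of_nonneg_right hne2 (by linarith : (0:ℝ) ≤ n)
      rw [hβ]; nlinarith
    have hrη : 0 < r * η := by positivity
    obtain ⟨y, hy2, hy⟩ := stab hn L β (by nlinarith) hbt
    obtain ⟨i, j, hij, hLy⟩ := Finset.card_eq_two.mp hy2
    have h1 := pair_count (by omega) A i j C' (k1 * n) t1 ht1 ht1' (fun c hc => hRF c (hC'C hc))
      (fun c hc => h3 c (hC'C hc) i j) ?_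
    · have h2 : (C'.card : ℝ) ≤ n * Real.exp (n * (Real.log 2 - κ)) := by
        refine h1.trans ?_
        apply mul_le_mul_of_nonneg_left _ (by linarith)
        apply Real.exp_le_exp.mpr
        have e1 := mul_le_mul_of_nonneg_right hp1 (by linarith : (0:ℝ) ≤ n)
        have e2 := mul_le_mul_of_nonneg_right hp2 (by linarith : (0:ℝ) ≤ n)
        have e3 := mul_le_mul_of_nonneg_right hκ1 (by linarith : (0:ℝ) ≤ n)
        have e4 := mul_le_mul_of_nonneg_right Real.log_two_gt_d9.le (by linarith : (0:ℝ) ≤ n)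
        linarith
      linarith
    · intro c hc
      have hs : (univ.filter (fun x => x ∉ A ∨ (c x ≠ i ∧ c x ≠ j))) ⊆
          (univ.filter (fun x => c x ∉ L x)) ∪ (univ.filter (fun x => L x ≠ L y)) := by
        intro x hx
        simp only [mem_filter, mem_univ, true_and, mem_union] at hx ⊢
        by_contra hcon
        push Not at hcon
        obtain ⟨q1, q2⟩ := hcon
        rcases hx with hx | hx
        · exact hx (hA x (by rw [q2, hy2]))
        · rw [q2, hLy] at q1
          simp only [mem_insert, mem_singleton] at q1
          tauto
      have := (Finset.card_le_card hs).trans (Finset.card_union_le _ _)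
      have h4 : ((univ.filter (fun x => x ∉ A ∨ (c x ≠ i ∧ c x ≠ j))).card : ℝ) ≤
        (univ.filter (fun x => c x ∉ L x)).card + (univ.filter (fun x => L x ≠ L y)).card := by exact_mod_cast this
      have h5 := hbad c hc
      have h6 := mul_le_mul_of_nonneg_right hk (by linarith : (0:ℝ) ≤ n)
      linarith


lemma small_exists (a b e : ℝ) (ha : 0 < a) (hb : 0 ≤ b) (he : 0 < e) : ∃ x : ℝ, 0 < x ∧ x * b ≤ a ∧ x ≤ e := by
  refine ⟨min (a / (b+1)) e, by positivity, ?_, min_le_right _ _⟩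
  have h1 : a / (b+1) * b ≤ a := by
    rw [div_mul_eq_mul_div, div_le_iff₀ (by positivity)]; nlinarith
  exact (mul_le_mul_of_nonneg_right (min_le_left _ _) hb).trans h1

set_option maxHeartbeats 1000000 in
lemma main_count (r : ℕ) (hr : 3 ≤ r) : ∃ n₁ : ℕ, ∀ n ≥ n₁, ∀ (A : Finset (Fin n)) (z0 : Fin r)
    (S : Finset (Fin n → Fin r)), (∀ c ∈ S, RF A c) → (∀ c ∈ S, ∀ x, x ∉ A → c x = z0) →
    (∀ c ∈ S, ∀ i j, ∃ x ∈ A, c x ≠ i ∧ c x ≠ j) → 8 * S.card ≤ 2 ^ n := by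
  have hr0 : (3:ℝ) ≤ r := by exact_mod_cast hr
  have hl2 : 0 < Real.log 2 := Real.log_pos (by norm_num)
  have hlr : 0 ≤ Real.log r := Real.log_nonneg (by linarith)
  have hlog : ∀ t : ℝ, 0 < t → t ≤ 1 → 0 ≤ Real.log (1/t) := by
    intro t h h'
    apply Real.log_nonneg
    rw [le_div_iff₀ h]; linarith
  obtain ⟨t1, ht1, hp1, ht1'⟩ := small_exists 0.01 (r+1) 1 (by norm_num) (by linarith) (by norm_num)
  obtain ⟨k1, hk1, hp2, hk1'⟩ := small_exists 0.005 (Real.log (1/t1)) (1/2) (by norm_num) (hlog _ ht1 ht1') (by norm_num)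
  obtain ⟨ε1, hε1, -, hε1'⟩ := small_exists 1 1 (k1/1000) (by norm_num) (by norm_num) (by positivity)
  obtain ⟨ε2, hε2, hq1, hε2'⟩ := small_exists (ε1 * Real.log 2 / 4) (Real.log r) ε1 (by positivity) hlr hε1
  obtain ⟨t2, ht2, hq2, ht2'⟩ := small_exists (ε1 * Real.log 2 / 4) r 1 (by positivity) (by linarith) (by norm_num)
  obtain ⟨η', hη', hq3, hη''⟩ := small_exists (ε1 * Real.log 2 / 4) (Real.log (1/t2)) (k1/10) (by positivity) (hlog _ ht2 ht2') (by positivity)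
  obtain ⟨η, hη, hηe⟩ : ∃ η : ℝ, 0 < η ∧ 2 * r * η = η' := ⟨η' / (2*r), by positivity, by field_simp⟩
  obtain ⟨κ, hκ, -, hκm⟩ := small_exists 1 1 (min 0.06 (ε1 * Real.log 2 / 4)) (by norm_num) (by norm_num) (by positivity)
  obtain ⟨cv, hcv, n₀, hvar⟩ := varnavides ε2 hε2
  obtain ⟨γ, hγ, hγ1, -⟩ := small_exists (min (cv/2) (k1/720)) ((r:ℝ)^3) 1 (by positivity) (by positivity) (by norm_num)
  obtain ⟨M, Ct, hCt, htypes⟩ := types r (γ * η^3/36) (κ/6) (by positivity) (by positivity)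
  obtain ⟨n2, hn2⟩ := exists_nat_ge (128 * Ct / κ^2)
  refine ⟨max (max 12 n₀) n2, ?_⟩
  intro n hn A z0 S hRF h0 h3
  have hn12 : 12 ≤ n := (le_max_left _ _).trans ((le_max_left _ _).trans hn)
  have hnn0 : n₀ ≤ n := (le_max_right _ _).trans ((le_max_left _ _).trans hn)
  have hnn2 : n2 ≤ n := (le_max_right _ _).trans hn
  have hn0 : (12:ℝ) ≤ n := by exact_mod_cast hn12
  obtain ⟨Φ, hΦ1, hΦ2⟩ := htypes (2*n+1) (α := Fin n → Fin r)
    (fun c i => indZ (A.filter (fun x => c x = i))) (fun c i x => indZ_norm _ _)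
  have hfib : ∀ b ∈ S.image Φ, ((S.filter (fun c => Φ c = b)).card : ℝ) ≤ 2 * n * Real.exp (n * (Real.log 2 - κ)) := by
    intro b hb
    obtain ⟨c0, hc0, hcb⟩ := mem_image.mp hb
    have hne : (S.filter (fun c => Φ c = b)).Nonempty := ⟨c0, mem_filter.mpr ⟨hc0, hcb⟩⟩
    refine class_lemma hr hn12 A _ hne η γ ε1 ε2 k1 t1 t2 κ cv z0 hη hγ.le hε1 hε2 ht1 ht1' ht2 ht2'
      (fun c hc => hRF c (mem_filter.mp hc).1) (fun c hc => h0 c (mem_filter.mp hc).1)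
      (fun c hc => h3 c (mem_filter.mp hc).1) ?_ (hvar n hnn0) ?_ ?_ hk1' hp1 (by linarith) hq1 hq2
      (by rw [hηe]; exact hq3) (hκm.trans (min_le_left _ _)) (hκm.trans (min_le_right _ _))
    · intro i j k hij hjk hik
      have hcb := class_bound A (S.filter (fun c => Φ c = b)) hne (2 * (γ * η^3/36) * (2*n+1:ℕ)) η (by positivity) hη.le
        (fun c hc => hRF c (mem_filter.mp hc).1)
        (fun c hc c' hc' i k => hΦ2 c c' ((mem_filter.mp hc).2.trans (mem_filter.mp hc').2.symm) i k) i j k hij hjk hik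
      have hN : ((2*n+1:ℕ):ℝ) ≤ 3 * n := by push_cast; linarith
      have h5 : 2 * (2 * (γ * η^3/36) * ((2*n+1:ℕ):ℝ)) * ((2*n+1:ℕ):ℝ) ≤ γ * (n:ℝ)^2 * η^3 := by
        calc _ = (γ * η^3/9) * (((2*n+1:ℕ):ℝ))^2 := by ring
          _ ≤ (γ * η^3/9) * (3 * n)^2 := by gcongr
          _ = _ := by ring
      exact le_of_mul_le_mul_right (hcb.trans h5) (by positivity)
    · have := hγ1.trans (min_le_left _ _); linarith
    · have := hγ1.trans (min_le_right _ _); rw [hηe]; linarith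
  have hS : (S.card : ℝ) ≤ (Ct * Real.exp (κ/6 * (2*n+1:ℕ))) * (2 * n * Real.exp (n * (Real.log 2 - κ))) := by
    rw [Finset.card_eq_sum_card_image Φ S]
    push_cast
    refine (Finset.sum_le_card_nsmul _ _ _ hfib).trans ?_
    rw [nsmul_eq_mul]
    apply mul_le_mul_of_nonneg_right _ (by positivity)
    have := hΦ1 S
    push_cast at this ⊢
    exact this
  have h2n : (2:ℝ)^n = Real.exp (n * Real.log 2) := by
    rw [Real.exp_nat_mul, Real.exp_log (by norm_num)]
  have hfin : 8 * (S.card : ℝ) ≤ 2 ^ n := by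
    have e1 : (Ct * Real.exp (κ/6 * (2*n+1:ℕ))) * (2 * n * Real.exp (n * (Real.log 2 - κ)))
        ≤ 2 * Ct * n * (Real.exp (-(κ * n / 2)) * 2^n) := by
      rw [h2n, ← Real.exp_add]
      calc _ = 2 * Ct * n * Real.exp (κ/6 * (2*n+1:ℕ) + n * (Real.log 2 - κ)) := by
            rw [Real.exp_add]; ring
        _ ≤ _ := by
            apply mul_le_mul_of_nonneg_left _ (by positivity)
            apply Real.exp_le_exp.mpr
            push_cast
            nlinarith
    have e2 : 16 * Ct * n ≤ Real.exp (κ * n / 2) := by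
      have q := Real.quadratic_le_exp_of_nonneg (by positivity : 0 ≤ κ * n / 2)
      have q2 : 128 * Ct / κ^2 ≤ n := by
        have a1 : (n2:ℝ) ≤ n := by exact_mod_cast hnn2
        linarith
      rw [div_le_iff₀ (by positivity)] at q2
      have q3 := mul_le_mul_of_nonneg_right q2 (by positivity : (0:ℝ) ≤ n)
      have q4 : 0 ≤ κ * n := by positivity
      nlinarith
    have e3 : Real.exp (-(κ * n / 2)) * Real.exp (κ * n / 2) = 1 := by rw [← Real.exp_add]; simp
    have e4 := Real.exp_pos (-(κ * n / 2))
    have e5 : 16 * Ct * n * Real.exp (-(κ * n / 2)) ≤ 1 := by nlinarith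
    calc 8 * (S.card : ℝ) ≤ 8 * (2 * Ct * n * (Real.exp (-(κ * n / 2)) * 2^n)) := by linarith
      _ = (16 * Ct * n * Real.exp (-(κ * n / 2))) * 2^n := by ring
      _ ≤ 1 * 2^n := by gcongr
      _ = _ := one_mul _
  exact_mod_cast hfin


lemma g_eq (r : ℕ) (A : Finset ℕ) [DecidablePred (fun c : A → Fin r => RainbowAPFree A c)] :
    g r A = (univ.filter (fun c : A → Fin r => RainbowAPFree A c)).card := by
  rw [g, Nat.card_eq_fintype_card, Fintype.card_subtype]

lemma g_lower (r n : ℕ) :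
    ((univ : Finset (Fin r × Fin r)).filter (fun p => p.1 < p.2)).card * (2^n - 2) ≤ g r (Finset.Icc 1 n) := by
  classical
  set P := ((univ : Finset (Fin r × Fin r)).filter (fun p => p.1 < p.2)) with hP
  let U : Finset (Finset.Icc 1 n → Bool) := univ \ {(fun _ => true), (fun _ => false)}
  have hU : 2^n - 2 ≤ U.card := by
    have h1 := Finset.le_card_sdiff ({(fun _ => true), (fun _ => false)} : Finset (Finset.Icc 1 n → Bool)) univ
    have h2 := Finset.card_le_two (a := (fun _ => true : Finset.Icc 1 n → Bool)) (b := (fun _ => false))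
    have h3 : (univ : Finset (Finset.Icc 1 n → Bool)).card = 2^n := by
      simp [Finset.card_univ]
    rw [h3] at h1
    exact le_trans (by omega) h1
  have hUt : ∀ f ∈ U, (∃ x, f x = true) ∧ (∃ x, f x = false) := by
    intro f hf
    simp only [U, mem_sdiff, mem_univ, true_and, mem_insert, mem_singleton, not_or] at hf
    constructor
    · by_contra hcon
      push Not at hcon
      exact hf.2 (funext fun x => by simpa using hcon x)
    · by_contra hcon
      push Not at hcon
      exact hf.1 (funext fun x => by simpa using hcon x)
  rw [g_eq]
  calc P.card * (2^n-2) ≤ P.card * U.card := Nat.mul_le_mul_left _ hU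
    _ = (P ×ˢ U).card := (Finset.card_product _ _).symm
    _ ≤ _ := by
      apply Finset.card_le_card_of_injOn (fun q x => if q.2 x then q.1.1 else q.1.2)
      · intro q _
        simp only [coe_filter, mem_univ, true_and, Set.mem_ofPred_eq]
        intro a d _ h1 h2 h3
        dsimp only
        split_ifs <;> simp
      · rintro ⟨⟨p1, p2⟩, f⟩ hq ⟨⟨q1, q2⟩, f'⟩ hq' he
        simp only [coe_product, Set.mem_prod, mem_coe, hP, mem_filter, mem_univ, true_and] at hq hq'
        obtain ⟨hp, hf⟩ := hq
        obtain ⟨hq, hf'⟩ := hq'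
        have he' : ∀ x, (if f x = true then p1 else p2) = (if f' x = true then q1 else q2) := fun x => congrFun he x
        obtain ⟨⟨x, hx⟩, ⟨y, hy⟩⟩ := hUt f hf
        have e1 := he' x
        have e2 := he' y
        simp only [hx, hy, if_true, Bool.false_eq_true, if_false] at e1 e2
        have hpq : p1 = q1 ∧ p2 = q2 := by
          rw [Fin.lt_def] at hp hq
          rw [Fin.ext_iff, Fin.ext_iff]
          split_ifs at e1 e2 <;> rw [Fin.ext_iff] at e1 e2 <;> omega
        obtain ⟨rfl, rfl⟩ := hpq
        have : f = f' := by
          funext z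
          have hz := he' z
          have hne : p1 ≠ p2 := ne_of_lt hp
          by_contra hcon
          cases hfz : f z <;> cases hfz' : f' z <;> rw [hfz, hfz'] at hz hcon
          · exact hcon rfl
          · exact hne hz.symm
          · exact hne hz
          · exact hcon rfl
        rw [this]

lemma g_upper (r : ℕ) (hr : 3 ≤ r) (n : ℕ)
    (hmain : ∀ (A : Finset (Fin n)) (z0 : Fin r)
    (S : Finset (Fin n → Fin r)), (∀ c ∈ S, RF A c) → (∀ c ∈ S, ∀ x, x ∉ A → c x = z0) →
    (∀ c ∈ S, ∀ i j, ∃ x ∈ A, c x ≠ i ∧ c x ≠ j) → 8 * S.card ≤ 2 ^ n)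
    (A : Finset ℕ) (hA : A ⊂ Finset.Icc 1 n) :
    8 * g r A ≤ 8 * (((univ : Finset (Fin r × Fin r)).filter (fun p => p.1 < p.2)).card * 2^(n-1)) + 2^n := by
  classical
  set P := ((univ : Finset (Fin r × Fin r)).filter (fun p => p.1 < p.2)) with hP
  rw [g_eq]
  set T := univ.filter (fun c : A → Fin r => RainbowAPFree A c) with hT
  let T3 := T.filter (fun c => ∀ i j, ∃ x, c x ≠ i ∧ c x ≠ j)
  let T2 := T.filter (fun c => ¬ ∀ i j, ∃ x, c x ≠ i ∧ c x ≠ j)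
  have hsplit : T3.card + T2.card = T.card := Finset.card_filter_add_card_filter_not _
  have hAcard : A.card ≤ n - 1 := by
    have := Finset.card_lt_card hA
    simp at this
    omega
  have hT2 : T2.card ≤ P.card * 2^(n-1) := by
    have hs : T2 ⊆ P.biUnion (fun p => Fintype.piFinset (fun _ : A => ({p.1, p.2} : Finset (Fin r)))) := by
      intro c hc
      simp only [T2, mem_filter] at hc
      have := hc.2
      push Not at this
      obtain ⟨i, j, hij⟩ := this
      have hkey : ∀ i j : Fin r, i ≠ j → (∀ x, c x = i ∨ c x = j) →
          c ∈ P.biUnion (fun p => Fintype.piFinset (fun _ : A => ({p.1, p.2} : Finset (Fin r)))) := by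
        intro i j hne h
        rw [mem_biUnion]
        rcases lt_or_gt_of_ne hne with hl | hl
        · refine ⟨(i, j), by simp [hP, hl], ?_⟩
          rw [Fintype.mem_piFinset]; intro x; simpa using h x
        · refine ⟨(j, i), by simp [hP, hl], ?_⟩
          rw [Fintype.mem_piFinset]; intro x; simpa using (h x).symm
      by_cases hne : i = j
      · subst hne
        have : Nontrivial (Fin r) := Fin.nontrivial_iff_two_le.mpr (by omega)
        obtain ⟨k, hk⟩ := exists_ne i
        apply hkey i k hk.symm
        intro x; left; by_contra h; exact h (hij x h)
      · apply hkey i j hne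
        intro x; by_contra h; push Not at h; exact h.2 (hij x h.1)
    refine (Finset.card_le_card hs).trans (Finset.card_biUnion_le.trans ?_)
    refine (Finset.sum_le_card_nsmul _ _ (2^(n-1)) ?_).trans (by simp)
    intro p _
    rw [Fintype.card_piFinset]
    simp only [prod_const, card_univ, Fintype.card_coe]
    calc _ ≤ 2 ^ A.card := Nat.pow_le_pow_left Finset.card_le_two _
      _ ≤ _ := Nat.pow_le_pow_right (by norm_num) hAcard
  have hT3 : 8 * T3.card ≤ 2^n := by
    let z0 : Fin r := ⟨0, by omega⟩
    let ext : (A → Fin r) → (Fin n → Fin r) := fun c x => if h : (x:ℕ)+1 ∈ A then c ⟨(x:ℕ)+1, h⟩ else z0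
    have hmem : ∀ a ∈ A, 1 ≤ a ∧ a ≤ n := fun a ha => Finset.mem_Icc.mp (hA.1 ha)
    have hext : ∀ c (a : A), ∃ x : Fin n, (x:ℕ)+1 ∈ A ∧ ext c x = c a := by
      intro c a
      obtain ⟨a, ha⟩ := a
      have := hmem a ha
      have e : a - 1 + 1 = a := by omega
      refine ⟨⟨a-1, by omega⟩, by simpa [e] using ha, ?_⟩
      simp only [ext, e, ha, dif_pos]
    have hinj : Function.Injective ext := by
      intro c c' h
      funext a
      obtain ⟨a, ha⟩ := a
      have := hmem a ha
      have e : a - 1 + 1 = a := by omega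
      have h' := congrFun h ⟨a-1, by omega⟩
      simpa only [ext, e, ha, dif_pos] using h'
    rw [← Finset.card_image_of_injective T3 hinj]
    apply hmain (univ.filter (fun x : Fin n => (x:ℕ)+1 ∈ A)) z0
    · intro c' hc'
      obtain ⟨c, hc, rfl⟩ := mem_image.mp hc'
      have hR : RainbowAPFree A c := by
        simp only [T3, hT, mem_filter, mem_univ, true_and] at hc; exact hc.1
      intro x hx y hy z hz hxyz
      simp only [mem_filter, mem_univ, true_and] at hx hy hz
      simp only [ext, hx, hy, hz, dif_pos]
      rcases lt_trichotomy (x:ℕ) y with hlt | heq | hgt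
      · have e1 : (y:ℕ) + 1 = (x+1) + (y - x) := by omega
        have e2 : (z:ℕ) + 1 = (x+1) + 2 * (y - x) := by omega
        have := hR (x+1) (y-x) (by omega) hx (e1 ▸ hy) (e2 ▸ hz)
        simpa only [← e1, ← e2] using this
      · left; congr 2; omega
      · have e1 : (y:ℕ) + 1 = (z+1) + (y - z) := by omega
        have e2 : (x:ℕ) + 1 = (z+1) + 2 * (y - z) := by omega
        have := hR (z+1) (y-z) (by omega) hz (e1 ▸ hy) (e2 ▸ hx)
        simp only [← e1, ← e2] at this
        rcases this with h | h | h
        · right; left; exact h.symm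
        · left; exact h.symm
        · right; right; exact h.symm
    · intro c' hc' x hx
      obtain ⟨c, hc, rfl⟩ := mem_image.mp hc'
      simp only [mem_filter, mem_univ, true_and] at hx
      simp only [ext, hx, dif_neg, not_false_eq_true]
    · intro c' hc' i j
      obtain ⟨c, hc, rfl⟩ := mem_image.mp hc'
      obtain ⟨a, ha⟩ := (mem_filter.mp hc).2 i j
      obtain ⟨x, hx, hxa⟩ := hext c a
      exact ⟨x, by simp [hx], by rw [hxa]; exact ha⟩
  omega

theorem stmt_3 (r : ℕ) (hr : 3 ≤ r) :
    ∃ n₁ : ℕ, ∀ n : ℕ, n₁ ≤ n → ∀ A : Finset ℕ, A ⊂ Finset.Icc 1 n →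
      g r A < g r (Finset.Icc 1 n) := by
  obtain ⟨n1, hn1⟩ := main_count r hr
  refine ⟨max n1 4, ?_⟩
  intro n hn A hA
  have h4 : 4 ≤ n := (le_max_right _ _).trans hn
  have h1 := g_upper r hr n (hn1 n ((le_max_left _ _).trans hn)) A hA
  have h2 := g_lower r n
  set m := ((univ : Finset (Fin r × Fin r)).filter (fun p => p.1 < p.2)).card with hm
  have hm1 : 1 ≤ m := by
    apply Finset.card_pos.mpr
    refine ⟨(⟨0, by omega⟩, ⟨1, by omega⟩), ?_⟩
    simp
  obtain ⟨k, rfl⟩ : ∃ k, n = k + 4 := ⟨n - 4, by omega⟩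
  have hk : 1 ≤ 2^k := Nat.one_le_two_pow
  have e1 : 2^(k+4) = 16 * 2^k := by ring
  have e2 : 2^(k+4-1) = 8 * 2^k := by
    rw [show k+4-1 = k+3 by omega]; ring
  rw [e1] at h1 h2
  rw [e2] at h1
  generalize 2^k = q at *
  obtain ⟨q', rfl⟩ : ∃ q', q = q' + 1 := ⟨q - 1, by omega⟩
  rw [show 16 * (q'+1) - 2 = 16 * q' + 14 by omega] at h2
  have h3 : q' ≤ m * q' := Nat.le_mul_of_pos_left _ hm1
  nlinarith
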